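/- Let σ ∈ ℂ\{0}, let p, q ∈ C¹([0,ℓ];ℝ), a ∈ C²([0,ℓ];ℝ) with a(x) > 0 on [0,ℓ], and let b ∈ C³([0,ℓ];ℂ) be such that its set of zeros in [0,ℓ] is finite and every zero is of order at most one. Suppose u, ũ ∈ C^{1,2}([0,T]×[0,ℓ];ℂ) satisfy σ∂_t u = a(x)∂_x²u − p(x)u and σ∂_t ũ = a(x)∂_x²ũ − q(x)ũ for 0<t<T, 0<x<ℓ, together with the FINAL condition u(T,·) = ũ(T,·) = b on (0,ℓ), u(t,0) = ũ(t,0) and ∂_x u(t,0) = ∂_x ũ(t,0) for 0<t<T. If moreover there exists ε ∈ (0,ℓ) such that p = q on [0,ε], then p = q on [0,ℓ]. -/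

import Mathlib

open Set MeasureTheory intervalIntegral

noncomputable section

/-- `u` is of class `C^{1,2}` on `[0,T] × [0,ℓ]`, with `ut`, `ux`, `uxx` its
partial derivatives `∂ₜu`, `∂ₓu`, `∂ₓ²u`. -/
def IsC12 (T ℓ : ℝ) (u ut ux uxx : ℝ → ℝ → ℂ) : Prop :=
  (∀ t ∈ Icc (0:ℝ) T, ∀ x ∈ Icc (0:ℝ) ℓ,
      HasDerivWithinAt (fun s => u s x) (ut t x) (Icc 0 T) t ∧
      HasDerivWithinAt (fun y => u t y) (ux t x) (Icc 0 ℓ) x ∧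
      HasDerivWithinAt (fun y => ux t y) (uxx t x) (Icc 0 ℓ) x) ∧
  ContinuousOn (fun z : ℝ × ℝ => u z.1 z.2) (Icc 0 T ×ˢ Icc 0 ℓ) ∧
  ContinuousOn (fun z : ℝ × ℝ => ut z.1 z.2) (Icc 0 T ×ˢ Icc 0 ℓ) ∧
  ContinuousOn (fun z : ℝ × ℝ => ux z.1 z.2) (Icc 0 T ×ˢ Icc 0 ℓ) ∧
  ContinuousOn (fun z : ℝ × ℝ => uxx z.1 z.2) (Icc 0 T ×ˢ Icc 0 ℓ)

open Complex Filter Asymptotics in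
/-- An entire function of order `1/2` which decays along two perpendicular rays vanishes. -/
theorem eq_zero_of_order_half {F : ℂ → ℂ} (hF : Differentiable ℂ F) {A B C : ℝ} (hB : 0 ≤ B)
    (hgrow : ∀ s, ‖F s‖ ≤ A * Real.exp (B * Real.sqrt ‖s‖))
    (h1 : ∀ x : ℝ, 0 ≤ x → ‖F ((1 + I) * x)‖ ≤ C / (1 + x))
    (h2 : ∀ x : ℝ, 0 ≤ x → ‖F ((1 - I) * x)‖ ≤ C / (1 + x)) (s : ℂ) : F s = 0 := by
  have hC : 0 ≤ C := by
    have := (norm_nonneg _).trans (h1 0 le_rfl)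
    simpa using this
  have hA : 0 ≤ A := by
    have := (norm_nonneg _).trans (hgrow 0)
    simpa using this
  have hle : ∀ x : ℝ, 0 ≤ x → C / (1 + x) ≤ C := fun x hx =>
    div_le_self hC (by linarith)
  have hcub : ∀ w : ℂ, ‖w‖ ≤ 2 → ∀ n : ℕ, 1 ≤ n → n ≤ 3 → ∀ z : ℂ, 0 ≤ z.re → 0 ≤ z.im →
      (∀ x : ℝ, 0 ≤ x → ‖F (w * (x : ℂ) ^ n)‖ ≤ C) →
      (∀ x : ℝ, 0 ≤ x → ‖F (w * ((x : ℂ) * I) ^ n)‖ ≤ C) → ‖F (w * z ^ n)‖ ≤ C := by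
    intro w hw n hn1 hn z hre him hx hy
    refine PhragmenLindelof.quadrant_I (f := fun z => F (w * z ^ n)) ?_ ?_ hx hy hre him
    · exact (hF.comp (by fun_prop)).diffContOnCl
    · refine ⟨3 / 2, by norm_num, B * Real.sqrt 2, ?_⟩
      refine IsBigO.of_bound A ?_
      refine Filter.Eventually.filter_mono inf_le_left ?_
      have h1 : ∀ᶠ z : ℂ in Bornology.cobounded ℂ, 1 ≤ ‖z‖ :=
        tendsto_norm_cobounded_atTop.eventually_ge_atTop 1
      filter_upwards [h1] with z hz
      refine (hgrow _).trans ?_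
      rw [Real.norm_of_nonneg (Real.exp_pos _).le]
      refine mul_le_mul_of_nonneg_left (Real.exp_le_exp.2 ?_) hA
      rw [mul_assoc]
      refine mul_le_mul_of_nonneg_left ?_ hB
      have h3 : ‖w * z ^ n‖ ≤ 2 * ‖z‖ ^ 3 := by
        rw [norm_mul, norm_pow]
        gcongr
      refine (Real.sqrt_le_sqrt h3).trans ?_
      rw [Real.sqrt_mul (by norm_num)]
      gcongr
      rw [Real.sqrt_eq_rpow, ← Real.rpow_natCast, ← Real.rpow_mul (norm_nonneg _)]
      norm_num
  have hnp : ‖(1 + I : ℂ)‖ ≤ 2 := (norm_add_le _ _).trans (by norm_num)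
  have hnm : ‖(1 - I : ℂ)‖ ≤ 2 := (norm_sub_le _ _).trans (by norm_num)
  have hbdd : ∀ s, ‖F s‖ ≤ C := by
    intro s
    have hw : (1 + I : ℂ) ≠ 0 := fun h => by simpa using congrArg re h
    obtain ⟨z, rfl⟩ : ∃ z, s = (1 + I) * z := ⟨s / (1 + I), by field_simp⟩
    by_cases hz : 0 ≤ z.re ∧ z.im ≤ 0
    · have hp := hcub (1 - I) hnm 1 le_rfl (by norm_num) (I * z) (by simpa using hz.2)
        (by simpa using hz.1)
        (fun x hx => by simpa using (h2 x hx).trans (hle x hx))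
        (fun x hx => by
          have : (1 - I) * ((x : ℂ) * I) ^ 1 = (1 + I) * x := by
            linear_combination -(x : ℂ) * I_sq
          rw [this]
          exact (h1 x hx).trans (hle x hx))
      have : (1 - I) * (I * z) ^ 1 = (1 + I) * z := by linear_combination -z * I_sq
      rwa [this] at hp
    · obtain ⟨ψ, hψ0, hψ1, hψ⟩ :
          ∃ ψ : ℝ, 0 ≤ ψ ∧ ψ ≤ 3 * (Real.pi / 2) ∧ (‖z‖ : ℂ) * exp (ψ * I) = z := by
        by_cases him : 0 ≤ z.im
        · exact ⟨arg z, arg_nonneg_iff.2 him,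
            (arg_le_pi z).trans (by linarith [Real.pi_pos]), norm_mul_exp_arg_mul_I z⟩
        · push Not at him
          have hre : z.re < 0 := by
            by_contra h
            exact hz ⟨not_lt.1 h, him.le⟩
          refine ⟨arg z + 2 * Real.pi, by linarith [neg_pi_lt_arg z, Real.pi_pos], ?_, ?_⟩
          · have : ¬ |arg z| ≤ Real.pi / 2 := by
              rw [abs_arg_le_pi_div_two_iff]
              exact not_le.2 hre
            have hneg : arg z < 0 := arg_neg_iff.2 him
            rw [abs_of_neg hneg] at this
            linarith
          · push_cast
            rw [add_mul, exp_add, exp_two_pi_mul_I, mul_one]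
            exact norm_mul_exp_arg_mul_I z
      set ζ : ℂ := ((‖z‖ ^ (1 / 3 : ℝ) : ℝ) : ℂ) * exp ((ψ / 3 : ℝ) * I) with hζ
      have hζ3 : ζ ^ 3 = z := by
        have e1 : (‖z‖ ^ (1 / 3 : ℝ)) ^ 3 = ‖z‖ := by
          rw [← Real.rpow_natCast, ← Real.rpow_mul (norm_nonneg _)]
          norm_num
        have e2 : exp ((ψ / 3 : ℝ) * I) ^ 3 = exp (ψ * I) := by
          rw [← exp_nat_mul]
          congr 1
          push_cast
          ring
        rw [hζ, mul_pow, e2, ← ofReal_pow, e1, hψ]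
      have hr : 0 ≤ ‖z‖ ^ (1 / 3 : ℝ) := by positivity
      have hp := hcub (1 + I) hnp 3 (by norm_num) le_rfl ζ
        (by
          rw [hζ, re_ofReal_mul, exp_ofReal_mul_I_re]
          exact mul_nonneg hr (Real.cos_nonneg_of_mem_Icc ⟨by linarith, by linarith⟩))
        (by
          rw [hζ, im_ofReal_mul, exp_ofReal_mul_I_im]
          exact mul_nonneg hr (Real.sin_nonneg_of_nonneg_of_le_pi (by linarith)
            (by linarith [Real.pi_pos])))
        (fun x hx => by
          have := (h1 (x ^ 3) (by positivity)).trans (hle (x ^ 3) (by positivity))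
          simpa using this)
        (fun x hx => by
          have : (1 + I) * ((x : ℂ) * I) ^ 3 = (1 - I) * ((x ^ 3 : ℝ) : ℂ) := by
            push_cast
            linear_combination (x : ℂ) ^ 3 * (I ^ 2 + I - 1) * I_sq
          rw [this]
          exact (h2 (x ^ 3) (by positivity)).trans (hle (x ^ 3) (by positivity)))
      rwa [hζ3] at hp
  have hconst : ∀ z, F z = F s := fun z =>
    hF.apply_eq_apply_of_bounded
      (isBounded_iff_forall_norm_le.2 ⟨C, by rintro _ ⟨z, rfl⟩; exact hbdd z⟩) z s
  have hlim : Tendsto (fun x : ℝ => C / (1 + x)) atTop (nhds 0) :=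
    tendsto_const_nhds.div_atTop (tendsto_atTop_add_const_left _ _ tendsto_id)
  have : ‖F s‖ ≤ 0 := by
    refine ge_of_tendsto hlim ?_
    filter_upwards [eventually_ge_atTop 0] with x hx
    rw [← hconst ((1 + I) * x)]
    exact h1 x hx
  exact norm_le_zero_iff.1 this

/-- The second antiderivative of `h` vanishing to second order at `0`. -/
def secondPrimitive (h : ℝ → ℂ) (x : ℝ) : ℂ :=
  ∫ y in (0:ℝ)..x, ((x - y : ℝ) : ℂ) * h y

theorem continuous_secondPrimitive {h : ℝ → ℂ} (hh : Continuous h) :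
    Continuous (secondPrimitive h) := by
  unfold secondPrimitive
  exact continuous_parametric_intervalIntegral_of_continuous
    (f := fun x y => ((x - y : ℝ) : ℂ) * h y) (by simp only [Function.uncurry_def]; fun_prop)
    continuous_id

theorem secondPrimitive_congr {h₁ h₂ : ℝ → ℂ} {x : ℝ} (hx : 0 ≤ x)
    (h : ∀ y ∈ Icc 0 x, h₁ y = h₂ y) : secondPrimitive h₁ x = secondPrimitive h₂ x := by
  refine integral_congr fun y hy => ?_
  rw [uIcc_of_le hx] at hy
  simp only [h y hy]

theorem secondPrimitive_add {h₁ h₂ : ℝ → ℂ} (hh₁ : Continuous h₁) (hh₂ : Continuous h₂) (x : ℝ) :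
    secondPrimitive (fun y => h₁ y + h₂ y) x = secondPrimitive h₁ x + secondPrimitive h₂ x := by
  unfold secondPrimitive
  rw [← integral_add (Continuous.intervalIntegrable (by fun_prop) _ _)
    (Continuous.intervalIntegrable (by fun_prop) _ _)]
  simp only [mul_add]

theorem secondPrimitive_const_mul (c : ℂ) (h : ℝ → ℂ) (x : ℝ) :
    secondPrimitive (fun y => c * h y) x = c * secondPrimitive h x := by
  unfold secondPrimitive
  rw [← intervalIntegral.integral_const_mul]
  simp only [mul_left_comm]

theorem secondPrimitive_sum (s : Finset ℕ) {h : ℕ → ℝ → ℂ} (hh : ∀ i, Continuous (h i)) (x : ℝ) :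
    secondPrimitive (fun y => ∑ i ∈ s, h i y) x = ∑ i ∈ s, secondPrimitive (h i) x := by
  unfold secondPrimitive
  rw [← integral_finsetSum fun i _ => Continuous.intervalIntegrable (by have := hh i; fun_prop) _ _]
  simp only [Finset.mul_sum]

theorem hasDerivAt_secondPrimitive {h : ℝ → ℂ} (hh : Continuous h) (x : ℝ) :
    HasDerivAt (secondPrimitive h) (∫ y in (0:ℝ)..x, h y) x := by
  have e : secondPrimitive h = fun x : ℝ =>
      (x : ℂ) * (∫ y in (0:ℝ)..x, h y) - ∫ y in (0:ℝ)..x, (y : ℂ) * h y := by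
    funext x
    unfold secondPrimitive
    rw [← intervalIntegral.integral_const_mul,
      ← integral_sub (Continuous.intervalIntegrable (by fun_prop) _ _)
      (Continuous.intervalIntegrable (by fun_prop) _ _)]
    refine integral_congr fun y _ => ?_
    push_cast
    ring
  rw [e]
  have h1 : HasDerivAt (fun x : ℝ => ∫ y in (0:ℝ)..x, h y) (h x) x :=
    (hh.integral_hasStrictDerivAt 0 x).hasDerivAt
  have hyh : Continuous fun y : ℝ => (y : ℂ) * h y := by fun_prop
  have h2 : HasDerivAt (fun x : ℝ => ∫ y in (0:ℝ)..x, (y : ℂ) * h y) ((x : ℂ) * h x) x :=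
    (hyh.integral_hasStrictDerivAt 0 x).hasDerivAt
  refine (((hasDerivAt_id x).ofReal_comp.mul h1).sub h2).congr_deriv ?_
  simp

/-- A function whose second derivative is `Z2` and whose Cauchy data at `0` vanish. -/
theorem eq_secondPrimitive {X : ℝ} {Z Z1 Z2 : ℝ → ℂ} (hZ : ContinuousOn Z (Icc 0 X))
    (hZ1 : ContinuousOn Z1 (Icc 0 X)) (hZ2 : ContinuousOn Z2 (Icc 0 X))
    (h1 : ∀ x ∈ Ioo 0 X, HasDerivAt Z (Z1 x) x) (h2 : ∀ x ∈ Ioo 0 X, HasDerivAt Z1 (Z2 x) x)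
    (h0 : Z 0 = 0) (h01 : Z1 0 = 0) {x : ℝ} (hx : x ∈ Icc 0 X) : Z x = secondPrimitive Z2 x := by
  have hsub : Icc 0 x ⊆ Icc 0 X := Icc_subset_Icc_right hx.2
  have key := integral_eq_sub_of_hasDerivAt_of_le (a := 0) (b := x)
    (f := fun y : ℝ => ((x - y : ℝ) : ℂ) * Z1 y + Z y)
    (f' := fun y : ℝ => ((x - y : ℝ) : ℂ) * Z2 y) hx.1
    (by
      have := hZ.mono hsub
      have := hZ1.mono hsub
      fun_prop)
    (fun y hy => by
      have hy' : y ∈ Ioo 0 X := ⟨hy.1, hy.2.trans_le hx.2⟩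
      have hl : HasDerivAt (fun y : ℝ => ((x - y : ℝ) : ℂ)) ((-1 : ℝ) : ℂ) y :=
        ((hasDerivAt_id y).const_sub x).ofReal_comp
      refine ((hl.mul (h2 y hy')).add (h1 y hy')).congr_deriv ?_
      push_cast
      ring)
    (by
      refine ContinuousOn.intervalIntegrable ?_
      rw [uIcc_of_le hx.1]
      have := hZ2.mono hsub
      fun_prop)
  unfold secondPrimitive
  rw [key]
  simp [h0, h01]

theorem eq_zero_of_secondPrimitive_eq_zero {X : ℝ} (hX : 0 < X) {h : ℝ → ℂ} (hh : Continuous h)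
    (h0 : ∀ x ∈ Icc 0 X, secondPrimitive h x = 0) : ∀ x ∈ Icc 0 X, h x = 0 := by
  have hI : ∀ x ∈ Ioo 0 X, ∫ y in (0:ℝ)..x, h y = 0 := fun x hx => by
    refine (hasDerivAt_secondPrimitive hh x).unique ?_
    refine (hasDerivAt_const x (0 : ℂ)).congr_of_eventuallyEq ?_
    filter_upwards [Ioo_mem_nhds hx.1 hx.2] with y hy using h0 y (Ioo_subset_Icc_self hy)
  have hi : ∀ x ∈ Ioo 0 X, h x = 0 := fun x hx => by
    refine (hh.integral_hasStrictDerivAt 0 x).hasDerivAt.unique ?_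
    refine (hasDerivAt_const x (0 : ℂ)).congr_of_eventuallyEq ?_
    filter_upwards [Ioo_mem_nhds hx.1 hx.2] with y hy using hI y hy
  rw [← closure_Ioo hX.ne]
  exact fun x hx => closure_minimal (s := Ioo 0 X) (t := {x | h x = 0}) hi
    (isClosed_eq hh continuous_const) hx

theorem norm_iterate_secondPrimitive_le {X M K : ℝ} {κ : ℝ → ℂ}
    (hK : ∀ x ∈ Icc 0 X, ‖κ x‖ ≤ K) {e : ℕ → ℝ → ℂ}
    (hrec : ∀ n, ∀ x ∈ Icc 0 X, e (n + 1) x = secondPrimitive (fun y => κ y * e n y) x)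
    (h0 : ∀ x ∈ Icc 0 X, ‖e 0 x‖ ≤ M) (n : ℕ) :
    ∀ x ∈ Icc 0 X, ‖e n x‖ ≤ M * K ^ n * (x ^ (2 * n) / (2 * n).factorial) := by
  induction n with
  | zero => intro x hx; simpa using h0 x hx
  | succ n ih =>
    intro x hx
    have hK0 : 0 ≤ K := (norm_nonneg _).trans (hK x hx)
    rw [hrec n x hx]
    have hle : ‖secondPrimitive (fun y => κ y * e n y) x‖ ≤ ∫ y in (0:ℝ)..x,
        M * K ^ (n + 1) / (2 * n).factorial * (x * y ^ (2 * n) - y ^ (2 * n + 1)) := by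
      refine norm_integral_le_of_norm_le hx.1 (ae_of_all _ fun y hy => ?_)
        (Continuous.intervalIntegrable (by fun_prop) _ _)
      have hy' : y ∈ Icc 0 X := ⟨hy.1.le, hy.2.trans hx.2⟩
      rw [norm_mul, norm_mul, Complex.norm_real, Real.norm_of_nonneg (by linarith [hy.2])]
      calc (x - y) * (‖κ y‖ * ‖e n y‖)
          ≤ (x - y) * (K * (M * K ^ n * (y ^ (2 * n) / (2 * n).factorial))) := by
            refine mul_le_mul_of_nonneg_left ?_ (by linarith [hy.2])
            exact mul_le_mul (hK y hy') (ih y hy') (norm_nonneg _) hK0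
        _ = _ := by ring
    refine hle.trans (le_of_eq ?_)
    rw [intervalIntegral.integral_const_mul, integral_sub
      (Continuous.intervalIntegrable (by fun_prop) _ _)
      (Continuous.intervalIntegrable (by fun_prop) _ _), intervalIntegral.integral_const_mul,
      integral_pow, integral_pow, show 2 * (n + 1) = 2 * n + 1 + 1 by ring, Nat.factorial_succ,
      Nat.factorial_succ]
    push_cast
    rw [zero_pow (by omega), zero_pow (by omega)]
    field_simp
    ring

/-- The terms of the Neumann series of the initial value problem
`Y'' = (lam + q) Y + H`, `Y(0) = Y'(0) = 0`. -/
def neumannTerm (q H : ℝ → ℂ) : ℕ → ℂ → ℝ → ℂ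
  | 0, _ => secondPrimitive H
  | n + 1, lam => secondPrimitive fun y => (lam + q y) * neumannTerm q H n lam y

theorem exists_coeff_neumannTerm {q H : ℝ → ℂ} (hq : Continuous q) (hH : Continuous H) (n : ℕ) :
    ∃ (N : ℕ) (c : ℕ → ℝ → ℂ), (∀ i, Continuous (c i)) ∧
      ∀ lam x, neumannTerm q H n lam x = ∑ i ∈ Finset.range N, lam ^ i * c i x := by
  induction n with
  | zero =>
    exact ⟨1, fun _ => secondPrimitive H, fun _ => continuous_secondPrimitive hH, by
      simp [neumannTerm]⟩
  | succ n ih =>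
    obtain ⟨N, c, hc, hsum⟩ := ih
    let c₁ : ℕ → ℝ → ℂ := fun i => if i < N then secondPrimitive fun y => q y * c i y else 0
    let c₂ : ℕ → ℝ → ℂ := fun i => if i = 0 then 0 else secondPrimitive (c (i - 1))
    have hcont : ∀ i, Continuous fun y => q y * c i y := fun i => hq.mul (hc i)
    refine ⟨N + 1, fun i x => c₁ i x + c₂ i x, fun i => ?_, fun lam x => ?_⟩
    · refine Continuous.add ?_ ?_
      · simp only [c₁]
        split_ifs
        · exact continuous_secondPrimitive (hcont i)
        · exact continuous_const
      · simp only [c₂]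
        split_ifs
        · exact continuous_const
        · exact continuous_secondPrimitive (hc _)
    · have e1 : neumannTerm q H (n + 1) lam x = secondPrimitive (fun y =>
          (∑ i ∈ Finset.range N, lam ^ i * (q y * c i y)) +
            ∑ i ∈ Finset.range N, lam ^ (i + 1) * c i y) x := by
        simp only [neumannTerm, hsum]
        congr 1
        funext y
        rw [add_mul, Finset.mul_sum, Finset.mul_sum, add_comm]
        congr 1 <;> refine Finset.sum_congr rfl fun i _ => ?_ <;> ring
      rw [e1, secondPrimitive_add (by have := hc; fun_prop) (by have := hc; fun_prop),
        secondPrimitive_sum _ (fun i => by have := hc i; fun_prop),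
        secondPrimitive_sum _ (fun i => by have := hc i; fun_prop)]
      simp only [secondPrimitive_const_mul, mul_add, Finset.sum_add_distrib]
      congr 1
      · rw [Finset.sum_range_succ]
        simp only [c₁, lt_irrefl, if_false, Pi.zero_apply, mul_zero, add_zero]
        refine Finset.sum_congr rfl fun i hi => ?_
        rw [if_pos (Finset.mem_range.1 hi)]
      · rw [Finset.sum_range_succ']
        simp [c₂]

theorem continuous_neumannTerm {q H : ℝ → ℂ} (hq : Continuous q) (hH : Continuous H) (n : ℕ)
    (lam : ℂ) : Continuous (neumannTerm q H n lam) := by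
  cases n with
  | zero => exact continuous_secondPrimitive hH
  | succ n =>
    exact continuous_secondPrimitive
      ((continuous_const.add hq).mul (continuous_neumannTerm hq hH n lam))

theorem differentiable_neumannTerm {q H : ℝ → ℂ} (hq : Continuous q) (hH : Continuous H) (n : ℕ)
    (x : ℝ) : Differentiable ℂ fun lam => neumannTerm q H n lam x := by
  obtain ⟨N, c, -, hc⟩ := exists_coeff_neumannTerm hq hH n
  simp only [hc]
  fun_prop

theorem exists_norm_neumannTerm_le {X : ℝ} {q H : ℝ → ℂ} (hq : Continuous q) (hH : Continuous H) :
    ∃ M Q : ℝ, 0 ≤ M ∧ 0 ≤ Q ∧ ∀ n lam, ∀ x ∈ Icc 0 X, ‖neumannTerm q H n lam x‖ ≤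
      M * ((X * Real.sqrt (‖lam‖ + Q)) ^ (2 * n) / (2 * n).factorial) := by
  obtain ⟨M, hM⟩ := isCompact_Icc.exists_bound_of_continuousOn (s := Icc 0 X)
    (continuous_secondPrimitive hH).continuousOn
  obtain ⟨Q, hQ⟩ := isCompact_Icc.exists_bound_of_continuousOn (s := Icc 0 X) hq.continuousOn
  refine ⟨max M 0, max Q 0, le_max_right _ _, le_max_right _ _, fun n lam x hx => ?_⟩
  have hK : ∀ x ∈ Icc 0 X, ‖lam + q x‖ ≤ ‖lam‖ + max Q 0 := fun x hx =>
    (norm_add_le _ _).trans (by gcongr; exact (hQ x hx).trans (le_max_left _ _))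
  refine (norm_iterate_secondPrimitive_le hK (e := fun n => neumannTerm q H n lam)
    (fun n x _ => rfl) (fun x hx => (hM x hx).trans (le_max_left _ 0)) n x hx).trans ?_
  rw [mul_pow, pow_mul (Real.sqrt _), Real.sq_sqrt (by positivity), mul_assoc]
  have hx0 := hx.1
  have : x ^ (2 * n) ≤ X ^ (2 * n) := by gcongr; exact hx.2
  calc max M 0 * ((‖lam‖ + max Q 0) ^ n * (x ^ (2 * n) / (2 * n).factorial))
      ≤ max M 0 * ((‖lam‖ + max Q 0) ^ n * (X ^ (2 * n) / (2 * n).factorial)) := by gcongr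
    _ = _ := by ring

/-- The solution of `Y'' = (lam + q) Y + H`, `Y(0) = Y'(0) = 0`. -/
def neumannSeries (q H : ℝ → ℂ) (lam : ℂ) (x : ℝ) : ℂ :=
  ∑' n, neumannTerm q H n lam x

theorem summable_neumannTerm {X : ℝ} {q H : ℝ → ℂ} (hq : Continuous q) (hH : Continuous H)
    (lam : ℂ) {x : ℝ} (hx : x ∈ Icc 0 X) : Summable fun n => neumannTerm q H n lam x := by
  obtain ⟨M, Q, -, -, hb⟩ := exists_norm_neumannTerm_le (X := X) hq hH
  exact Summable.of_norm_bounded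
    ((Real.hasSum_cosh (X * Real.sqrt (‖lam‖ + Q))).summable.mul_left M)
    fun n => hb n lam x hx

theorem differentiable_neumannSeries {X : ℝ} {q H : ℝ → ℂ} (hq : Continuous q)
    (hH : Continuous H) {x : ℝ} (hx : x ∈ Icc 0 X) :
    Differentiable ℂ fun lam => neumannSeries q H lam x := by
  obtain ⟨M, Q, hM, hQ, hb⟩ := exists_norm_neumannTerm_le (X := X) hq hH
  have hX : 0 ≤ X := hx.1.trans hx.2
  intro lam
  have hd : DifferentiableOn ℂ (fun lam => neumannSeries q H lam x)
      (Metric.ball 0 (‖lam‖ + 1)) := by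
    refine Complex.differentiableOn_tsum_of_summable_norm
      (u := fun n => M * ((X * Real.sqrt ((‖lam‖ + 1) + Q)) ^ (2 * n) / (2 * n).factorial))
      ((Real.hasSum_cosh _).summable.mul_left M)
      (fun n => (differentiable_neumannTerm hq hH n x).differentiableOn) Metric.isOpen_ball
      fun n w hw => (hb n w x hx).trans ?_
    have : ‖w‖ ≤ ‖lam‖ + 1 := (mem_ball_zero_iff.1 hw).le
    gcongr
  exact hd.differentiableAt (Metric.isOpen_ball.mem_nhds (by simp))

theorem exists_norm_neumannSeries_le {X : ℝ} (hX : 0 ≤ X) {q H : ℝ → ℂ} (hq : Continuous q)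
    (hH : Continuous H) : ∃ A : ℝ, 0 ≤ A ∧ ∀ lam, ∀ x ∈ Icc 0 X,
      ‖neumannSeries q H lam x‖ ≤ A * Real.exp (X * Real.sqrt ‖lam‖) := by
  obtain ⟨M, Q, hM, hQ, hb⟩ := exists_norm_neumannTerm_le (X := X) hq hH
  refine ⟨M * Real.exp (X * Real.sqrt Q), by positivity, fun lam x hx => ?_⟩
  have h1 := tsum_of_norm_bounded
    ((Real.hasSum_cosh (X * Real.sqrt (‖lam‖ + Q))).mul_left M) fun n => hb n lam x hx
  refine h1.trans ?_
  rw [mul_assoc, ← Real.exp_add]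
  refine mul_le_mul_of_nonneg_left ?_ hM
  have h2 : Real.sqrt (‖lam‖ + Q) ≤ Real.sqrt ‖lam‖ + Real.sqrt Q := by
    rw [Real.sqrt_le_left (by positivity)]
    have h3 := Real.sq_sqrt (norm_nonneg lam)
    have h4 := Real.sq_sqrt hQ
    have h5 : 0 ≤ Real.sqrt ‖lam‖ * Real.sqrt Q := by positivity
    nlinarith
  have h6 : Real.cosh (X * Real.sqrt (‖lam‖ + Q)) ≤ Real.exp (X * Real.sqrt (‖lam‖ + Q)) := by
    have h0 : 0 ≤ X * Real.sqrt (‖lam‖ + Q) := by positivity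
    rw [Real.cosh_eq]
    linarith [Real.exp_le_exp.2 (show -(X * Real.sqrt (‖lam‖ + Q)) ≤
      X * Real.sqrt (‖lam‖ + Q) by linarith)]
  refine h6.trans (Real.exp_le_exp.2 ?_)
  nlinarith

theorem eq_neumannSeries {X : ℝ} {q A U Z : ℝ → ℂ} (hq : Continuous q) (hA : Continuous A)
    (hU : Continuous U) (hZ : Continuous Z) {lam c : ℂ}
    (h : ∀ x ∈ Icc 0 X,
      Z x = secondPrimitive (fun y => (lam + q y) * Z y + (A y - c * U y)) x)
    {x : ℝ} (hx : x ∈ Icc 0 X) :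
    Z x = neumannSeries q A lam x - c * neumannSeries q U lam x := by
  let d : ℕ → ℝ → ℂ := fun n y => neumannTerm q A n lam y - c * neumannTerm q U n lam y
  have hd : ∀ n, Continuous (d n) := fun n =>
    (continuous_neumannTerm hq hA n lam).sub
      (continuous_const.mul (continuous_neumannTerm hq hU n lam))
  have hlq : Continuous fun y => lam + q y := continuous_const.add hq
  have hd0 : ∀ x, d 0 x = secondPrimitive (fun y => A y - c * U y) x := fun x => by
    have := secondPrimitive_add (h₁ := A) (h₂ := fun y => (-c) * U y) hA (by fun_prop) x
    rw [secondPrimitive_const_mul] at this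
    simp only [d, neumannTerm, sub_eq_add_neg, ← neg_mul, this]
  have hdrec : ∀ n x, d (n + 1) x = secondPrimitive (fun y => (lam + q y) * d n y) x := by
    intro n x
    have hA' := continuous_neumannTerm hq hA n lam
    have hU' := continuous_neumannTerm hq hU n lam
    have := secondPrimitive_add (h₁ := fun y => (lam + q y) * neumannTerm q A n lam y)
      (h₂ := fun y => (-c) * ((lam + q y) * neumannTerm q U n lam y)) (by fun_prop)
      (by fun_prop) x
    rw [secondPrimitive_const_mul] at this
    simp only [d, neumannTerm]
    rw [sub_eq_add_neg, ← neg_mul, ← this]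
    congr 1
    funext y
    ring
  let e : ℕ → ℝ → ℂ := fun n y => Z y - ∑ i ∈ Finset.range n, d i y
  have he : ∀ n, ∀ x ∈ Icc 0 X,
      e (n + 1) x = secondPrimitive (fun y => (lam + q y) * e n y) x := by
    intro n x hx
    have hen : Continuous (e n) := hZ.sub (continuous_finsetSum _ fun i _ => hd i)
    have e1 : (fun y => (lam + q y) * Z y + (A y - c * U y)) = fun y =>
        (lam + q y) * e n y + (A y - c * U y) + ∑ i ∈ Finset.range n, (lam + q y) * d i y := by
      funext y
      simp only [e, mul_sub, Finset.mul_sum]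
      ring
    have e2 : Z x = e (n + 1) x + ∑ i ∈ Finset.range (n + 1), d i x := by simp [e]
    have e3 := h x hx
    rw [e1, secondPrimitive_add (by fun_prop) (by fun_prop),
      secondPrimitive_add (by fun_prop) (by fun_prop),
      secondPrimitive_sum _ (h := fun i y => (lam + q y) * d i y) (fun i => hlq.mul (hd i)), e2,
      Finset.sum_range_succ', hd0] at e3
    simp only [hdrec] at e3
    linear_combination e3
  obtain ⟨M, hM⟩ := isCompact_Icc.exists_bound_of_continuousOn (s := Icc 0 X) hZ.continuousOn
  obtain ⟨K, hK⟩ := isCompact_Icc.exists_bound_of_continuousOn (s := Icc 0 X) hlq.continuousOn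
  have hK0 : 0 ≤ K := (norm_nonneg _).trans (hK x hx)
  have hbound := fun n => norm_iterate_secondPrimitive_le hK (e := e) he
    (fun x hx => by simpa [e] using hM x hx) n x hx
  have hlim : Filter.Tendsto (fun n => e n x) Filter.atTop (nhds 0) := by
    have := (Real.hasSum_cosh (x * Real.sqrt K)).summable.tendsto_atTop_zero.const_mul M
    rw [mul_zero] at this
    refine squeeze_zero_norm (fun n => (hbound n).trans (le_of_eq ?_)) this
    rw [mul_pow, pow_mul (Real.sqrt _), Real.sq_sqrt hK0]
    ring
  have hs : HasSum (fun n => d n x) (neumannSeries q A lam x - c * neumannSeries q U lam x) :=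
    (summable_neumannTerm hq hA lam hx).hasSum.sub
      ((summable_neumannTerm hq hU lam hx).hasSum.mul_left c)
  have := hlim.add hs.tendsto_sum_nat
  simp only [e, sub_add_cancel, zero_add] at this
  exact tendsto_nhds_unique tendsto_const_nhds this

theorem eq_zero_of_neumannSeries_eq_zero {X : ℝ} (hX : 0 < X) {q H : ℝ → ℂ} (hq : Continuous q)
    (hH : Continuous H) {lam : ℂ} (h : ∀ x ∈ Icc 0 X, neumannSeries q H lam x = 0) :
    ∀ x ∈ Icc 0 X, H x = 0 := by
  refine eq_zero_of_secondPrimitive_eq_zero hX hH fun x hx => ?_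
  obtain ⟨M, Q, hM, hQ, hb⟩ := exists_norm_neumannTerm_le (X := X) hq hH
  let S : ℕ → ℝ → ℂ := fun n y => ∑ i ∈ Finset.range n, neumannTerm q H i lam y
  have hS0 : ∀ x ∈ Icc 0 X, Filter.Tendsto (fun n => S n x) Filter.atTop (nhds 0) :=
    fun x hx => by
      have := (summable_neumannTerm hq hH lam hx).hasSum.tendsto_sum_nat
      rwa [show ∑' n, neumannTerm q H n lam x = 0 from h x hx] at this
  have hterm := fun i => continuous_neumannTerm hq hH i lam
  have hlq : Continuous fun y => lam + q y := continuous_const.add hq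
  have hSrec : ∀ n, S (n + 1) x =
      secondPrimitive (fun y => (lam + q y) * S n y) x + secondPrimitive H x := by
    intro n
    simp only [S, Finset.mul_sum]
    rw [secondPrimitive_sum _ (h := fun i y => (lam + q y) * neumannTerm q H i lam y)
      (fun i => hlq.mul (hterm i)), Finset.sum_range_succ']
    rfl
  have hSb : ∀ n, ∀ x ∈ Icc 0 X, ‖S n x‖ ≤
      ∑' n : ℕ, M * ((X * Real.sqrt (‖lam‖ + Q)) ^ (2 * n) / (2 * n).factorial) := by
    intro n x hx
    refine (norm_sum_le _ _).trans ((Finset.sum_le_sum fun i _ => hb i lam x hx).trans ?_)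
    refine Summable.sum_le_tsum _ (fun i _ => ?_) ((Real.hasSum_cosh _).summable.mul_left M)
    have := hX.le
    positivity
  have hlim : Filter.Tendsto (fun n => secondPrimitive (fun y => (lam + q y) * S n y) x)
      Filter.atTop (nhds (∫ y in (0:ℝ)..x, 0)) := by
    refine tendsto_integral_filter_of_dominated_convergence
      (fun y => ‖((x - y : ℝ) : ℂ)‖ * (‖lam + q y‖ *
        ∑' n : ℕ, M * ((X * Real.sqrt (‖lam‖ + Q)) ^ (2 * n) / (2 * n).factorial)))
      ?_ ?_ ?_ ?_
    · refine Filter.Eventually.of_forall fun n => Continuous.aestronglyMeasurable ?_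
      have : Continuous (S n) := continuous_finsetSum _ fun i _ => hterm i
      fun_prop
    · refine Filter.Eventually.of_forall fun n => ae_of_all _ fun y hy => ?_
      rw [uIoc_of_le hx.1] at hy
      rw [norm_mul, norm_mul]
      gcongr
      exact hSb n y ⟨hy.1.le, hy.2.trans hx.2⟩
    · exact Continuous.intervalIntegrable (by fun_prop) _ _
    · refine ae_of_all _ fun y hy => ?_
      rw [uIoc_of_le hx.1] at hy
      simpa using ((hS0 y ⟨hy.1.le, hy.2.trans hx.2⟩).const_mul (lam + q y)).const_mul
        ((x - y : ℝ) : ℂ)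
  have h1 := (hS0 x hx).comp (Filter.tendsto_add_atTop_nat 1)
  have h2 := hlim.add_const (secondPrimitive H x)
  have h3 := tendsto_nhds_unique h1 (h2.congr fun n => (hSrec n).symm)
  simpa using h3.symm

theorem exp_sqrt_decay {T B : ℝ} (hT : 0 < T) : ∃ C : ℝ, ∀ x : ℝ, 0 ≤ x →
    Real.exp (-(x * T)) * Real.exp (B * Real.sqrt x) ≤ C / (1 + x) := by
  refine ⟨Real.exp (B ^ 2 / (2 * T)) * (1 + 2 / T), fun x hx => ?_⟩
  rw [le_div_iff₀ (by linarith), ← Real.exp_add]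
  have h1 : 1 + x ≤ (1 + 2 / T) * Real.exp (x * T / 2) := by
    have h2 : x * T / 2 + 1 ≤ Real.exp (x * T / 2) := Real.add_one_le_exp _
    have h3 : 1 + x ≤ (1 + 2 / T) * (x * T / 2 + 1) := by
      have : (1 + 2 / T) * (x * T / 2 + 1) = 1 + x + (2 / T + x * T / 2) := by
        field_simp
        ring
      rw [this]
      have : 0 ≤ 2 / T + x * T / 2 := by positivity
      linarith
    exact h3.trans (by gcongr)
  have h4 : -(x * T) + B * Real.sqrt x ≤ B ^ 2 / (2 * T) - x * T / 2 := by
    have h5 := Real.sq_sqrt hx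
    have h6 : B ^ 2 / (2 * T) - x * T / 2 - (-(x * T) + B * Real.sqrt x)
        = (B - T * Real.sqrt x) ^ 2 / (2 * T) := by
      field_simp
      linear_combination -(T ^ 2) * h5
    have : 0 ≤ (B - T * Real.sqrt x) ^ 2 / (2 * T) := by positivity
    linarith
  calc Real.exp (-(x * T) + B * Real.sqrt x) * (1 + x)
      ≤ Real.exp (B ^ 2 / (2 * T) - x * T / 2) * ((1 + 2 / T) * Real.exp (x * T / 2)) := by
        gcongr
    _ = Real.exp (B ^ 2 / (2 * T)) * (1 + 2 / T) := by
        rw [Real.exp_sub]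
        field_simp

/-- If the forcing `A - exp (-s T) U` of the family of initial value problems
`Z'' = (-σ s + q) Z + A - exp (-s T) U`, `Z(0) = Z'(0) = 0` produces solutions which decay
like `1 / (1 + Re s)` in the right half plane, then `A` vanishes. -/
theorem forcing_eq_zero {X T C : ℝ} (hX : 0 < X) (hT : 0 < T) {σ : ℂ}
    {q A U : ℝ → ℂ} (hq : Continuous q) (hA : Continuous A) (hU : Continuous U)
    {Z : ℂ → ℝ → ℂ} (hZc : ∀ s : ℂ, 0 ≤ s.re → Continuous (Z s))
    (hZ : ∀ s : ℂ, 0 ≤ s.re → ∀ x ∈ Icc 0 X, Z s x = secondPrimitive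
      (fun y => (-σ * s + q y) * Z s y + (A y - Complex.exp (-s * T) * U y)) x)
    (hb : ∀ s : ℂ, 0 ≤ s.re → ∀ x ∈ Icc 0 X, ‖Z s x‖ ≤ C / (1 + s.re)) :
    ∀ x ∈ Icc 0 X, A x = 0 := by
  refine eq_zero_of_neumannSeries_eq_zero (lam := -σ * 0) hX hq hA fun x hx => ?_
  obtain ⟨MA, hMA, hbA⟩ := exists_norm_neumannSeries_le hX.le hq hA
  obtain ⟨MU, hMU, hbU⟩ := exists_norm_neumannSeries_le hX.le hq hU
  have hsq : ∀ s : ℂ, X * Real.sqrt ‖-σ * s‖ = X * Real.sqrt ‖σ‖ * Real.sqrt ‖s‖ := fun s => by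
    rw [norm_mul, norm_neg, Real.sqrt_mul (norm_nonneg _), mul_assoc]
  obtain ⟨C', hC'⟩ := exp_sqrt_decay (B := X * Real.sqrt ‖σ‖ * Real.sqrt 2) hT
  have hray : ∀ w : ℂ, w.re = 1 → ‖w‖ ≤ 2 → ∀ y : ℝ, 0 ≤ y →
      ‖neumannSeries q A (-σ * (w * y)) x‖ ≤ (C + MU * C') / (1 + y) := by
    intro w hw hwn y hy
    have hre : (w * y).re = y := by simp [hw]
    have hre0 : 0 ≤ (w * y).re := by rwa [hre]
    have hrep := eq_neumannSeries hq hA hU (hZc _ hre0) (hZ _ hre0) hx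
    rw [eq_sub_iff_add_eq] at hrep
    rw [← hrep, add_div]
    refine (norm_add_le _ _).trans (add_le_add ?_ ?_)
    · simpa [hre] using hb _ hre0 x hx
    · rw [norm_mul, Complex.norm_exp]
      have hre' : (-(w * y) * (T : ℂ)).re = -(y * T) := by simp [hw]
      rw [hre', mul_div_assoc]
      have hn : Real.sqrt ‖w * y‖ ≤ Real.sqrt 2 * Real.sqrt y := by
        rw [← Real.sqrt_mul (by norm_num), norm_mul, Complex.norm_of_nonneg hy]
        gcongr
      calc Real.exp (-(y * T)) * ‖neumannSeries q U (-σ * (w * y)) x‖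
          ≤ Real.exp (-(y * T)) * (MU * Real.exp (X * Real.sqrt ‖σ‖ * Real.sqrt 2 *
              Real.sqrt y)) := by
            refine mul_le_mul_of_nonneg_left ((hbU _ x hx).trans ?_) (Real.exp_pos _).le
            rw [hsq, mul_assoc (X * Real.sqrt ‖σ‖)]
            gcongr
        _ = MU * (Real.exp (-(y * T)) * Real.exp (X * Real.sqrt ‖σ‖ * Real.sqrt 2 *
              Real.sqrt y)) := by ring
        _ ≤ _ := mul_le_mul_of_nonneg_left (hC' y hy) hMU
  refine eq_zero_of_order_half (A := MA) (C := C + MU * C') (F := fun s => neumannSeries q A (-σ * s) x)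
    ((differentiable_neumannSeries hq hA hx).comp (by fun_prop))
    (B := X * Real.sqrt ‖σ‖) (by positivity) (fun s => ?_)
    (hray (1 + Complex.I) (by simp) ((norm_add_le _ _).trans (by norm_num)))
    (hray (1 - Complex.I) (by simp) ((norm_sub_le _ _).trans (by norm_num))) 0
  rw [← hsq]
  exact hbA _ x hx

/-- Differentiation of an integral with fixed limits and `C¹` dependence on the parameter. -/
theorem hasDerivAt_integral_param {Φ Φ' : ℝ → ℝ → ℂ} (hΦ : Continuous (Function.uncurry Φ))
    (hΦ' : Continuous (Function.uncurry Φ'))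
    (hd : ∀ x y, HasDerivAt (fun x => Φ x y) (Φ' x y) x) (a b x : ℝ) :
    HasDerivAt (fun x => ∫ y in a..b, Φ x y) (∫ y in a..b, Φ' x y) x := by
  obtain ⟨M, hM⟩ := (isCompact_Icc.prod isCompact_uIcc).exists_bound_of_continuousOn
    (s := Icc (x - 1) (x + 1) ×ˢ uIcc a b) hΦ'.continuousOn
  have hc : ∀ x, Continuous (Φ x) := fun x => hΦ.comp (by fun_prop : Continuous fun y => (x, y))
  refine (hasDerivAt_integral_of_dominated_loc_of_deriv_le (bound := fun _ => M)
    (Icc_mem_nhds (by linarith) (by linarith : x < x + 1))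
    (Filter.Eventually.of_forall fun z => (hc z).aestronglyMeasurable)
    ((hc x).intervalIntegrable _ _)
    (hΦ'.comp (by fun_prop : Continuous fun y => (x, y))).aestronglyMeasurable
    (ae_of_all _ fun y hy z hz => hM (z, y) ⟨hz, uIoc_subset_uIcc hy⟩)
    intervalIntegrable_const (ae_of_all _ fun y _ z _ => hd z y)).2

/-- Differentiation along a characteristic line of a function with continuous partial
derivatives. -/
theorem hasDerivAt_characteristic {k k₁ k₂ : ℝ → ℝ → ℂ} (hk₁ : Continuous (Function.uncurry k₁))
    (hk₂ : Continuous (Function.uncurry k₂))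
    (hd₁ : ∀ x y, HasDerivAt (fun x => k x y) (k₁ x y) x)
    (hd₂ : ∀ x y, HasDerivAt (fun y => k x y) (k₂ x y) y) (x y : ℝ) :
    HasDerivAt (fun y => k (x - y) y) (k₂ (x - y) y - k₁ (x - y) y) y := by
  have h := hasStrictFDerivAt_uncurry_coprod (𝕜 := ℝ) (u := (x - y, y)) (f := k)
    (f₁ := fun x y => ContinuousLinearMap.toSpanSingleton ℝ (k₁ x y))
    (f₂ := fun x y => ContinuousLinearMap.toSpanSingleton ℝ (k₂ x y))
    (Filter.Eventually.of_forall fun v => (hd₁ v.1 v.2).hasFDerivAt)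
    (Filter.Eventually.of_forall fun v => (hd₂ v.1 v.2).hasFDerivAt)
    (by
      have : Continuous fun z : ℝ × ℝ => ContinuousLinearMap.toSpanSingleton ℝ (k₁ z.1 z.2) :=
        (ContinuousLinearMap.toSpanSingletonCLE (𝕜 := ℝ) (E := ℂ)).continuous.comp hk₁
      exact this.continuousAt)
    (by
      have : Continuous fun z : ℝ × ℝ => ContinuousLinearMap.toSpanSingleton ℝ (k₂ z.1 z.2) :=
        (ContinuousLinearMap.toSpanSingletonCLE (𝕜 := ℝ) (E := ℂ)).continuous.comp hk₂
      exact this.continuousAt)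
  have hl : HasDerivAt (fun y : ℝ => (x - y, y)) ((-1 : ℝ), (1 : ℝ)) y :=
    ((hasDerivAt_id y).const_sub x).prodMk (hasDerivAt_id y)
  refine (HasFDerivAt.comp_hasDerivAt (f := fun y : ℝ => (x - y, y)) y h.hasFDerivAt hl).congr_deriv ?_
  simp [Function.HasUncurry.uncurry]
  ring

/-- The solution of the Goursat problem `∂_ξ ∂_η k = φ`, `k(ξ, 0) = ½ ∫_c^ξ f`, `k(c, η) = 0`. -/
def goursat (c : ℝ) (f : ℝ → ℂ) (φ : ℝ → ℝ → ℂ) (ξ η : ℝ) : ℂ :=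
  (1 / 2) * (∫ s in c..ξ, f s) + ∫ s in c..ξ, ∫ t in (0:ℝ)..η, φ s t

section Goursat

variable {c : ℝ} {f : ℝ → ℂ} {φ : ℝ → ℝ → ℂ}

theorem continuous_integral_snd (hφ : Continuous (Function.uncurry φ)) :
    Continuous (Function.uncurry fun s η => ∫ t in (0:ℝ)..η, φ s t) := by
  exact continuous_parametric_intervalIntegral_of_continuous
    (f := fun (z : ℝ × ℝ) t => φ z.1 t)
    (hφ.comp (by fun_prop : Continuous fun z : (ℝ × ℝ) × ℝ => (z.1.1, z.2))) continuous_snd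

theorem continuous_integral_fst (hφ : Continuous (Function.uncurry φ)) :
    Continuous (Function.uncurry fun ξ t => ∫ s in c..ξ, φ s t) := by
  exact continuous_parametric_intervalIntegral_of_continuous
    (f := fun (z : ℝ × ℝ) s => φ s z.2)
    (hφ.comp (by fun_prop : Continuous fun z : (ℝ × ℝ) × ℝ => (z.2, z.1.2))) continuous_fst

theorem continuous_goursat (hf : Continuous f) (hφ : Continuous (Function.uncurry φ)) :
    Continuous (Function.uncurry (goursat c f φ)) := by
  have h1 : Continuous fun ξ : ℝ => ∫ s in c..ξ, f s :=
    continuous_primitive (fun a b => hf.intervalIntegrable a b) c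
  have h2 := continuous_integral_fst (c := c) (continuous_integral_snd hφ)
  exact (continuous_const.mul (h1.comp continuous_fst)).add h2

theorem hasDerivAt_goursat_fst (hf : Continuous f) (hφ : Continuous (Function.uncurry φ))
    (ξ η : ℝ) : HasDerivAt (fun ξ => goursat c f φ ξ η)
      ((1 / 2) * f ξ + ∫ t in (0:ℝ)..η, φ ξ t) ξ := by
  have h : Continuous fun s => ∫ t in (0:ℝ)..η, φ s t :=
    (continuous_integral_snd hφ).comp (by fun_prop : Continuous fun s : ℝ => (s, η))
  exact ((hf.integral_hasStrictDerivAt c ξ).hasDerivAt.const_mul (1 / 2 : ℂ)).add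
    (h.integral_hasStrictDerivAt c ξ).hasDerivAt

theorem hasDerivAt_goursat_snd (hφ : Continuous (Function.uncurry φ))
    (ξ η : ℝ) : HasDerivAt (fun η => goursat c f φ ξ η) (∫ s in c..ξ, φ s η) η := by
  have hsw : Continuous fun z : ℝ × ℝ => (z.2, z.1) := by fun_prop
  refine (hasDerivAt_integral_param (Φ := fun η s => ∫ t in (0:ℝ)..η, φ s t)
    (Φ' := fun η s => φ s η) ((continuous_integral_snd hφ).comp hsw) (hφ.comp hsw)
    (fun η s => ?_) c ξ η).const_add _
  have h : Continuous (φ s) := hφ.comp (by fun_prop : Continuous fun t : ℝ => (s, t))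
  exact (h.integral_hasStrictDerivAt 0 η).hasDerivAt

theorem hasDerivAt_goursat_snd_fst (hφ : Continuous (Function.uncurry φ)) (ξ η : ℝ) :
    HasDerivAt (fun ξ => ∫ s in c..ξ, φ s η) (φ ξ η) ξ := by
  have h : Continuous fun s => φ s η := hφ.comp (by fun_prop : Continuous fun s : ℝ => (s, η))
  exact (h.integral_hasStrictDerivAt c ξ).hasDerivAt

theorem goursat_eq_zero (hf : ∀ s ≤ c, f s = 0) (hφ : ∀ s ≤ c, ∀ t, φ s t = 0) {ξ : ℝ}
    (hξ : ξ ≤ c) (η : ℝ) : goursat c f φ ξ η = 0 := by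
  have h1 : ∫ s in c..ξ, f s = ∫ s in c..ξ, (0 : ℂ) := integral_congr fun s hs => by
    rw [uIcc_of_ge hξ] at hs
    exact hf s hs.2
  have h2 : ∫ s in c..ξ, (∫ t in (0:ℝ)..η, φ s t) = ∫ s in c..ξ, (0 : ℂ) :=
    integral_congr fun s hs => by
      rw [uIcc_of_ge hξ] at hs
      simp [hφ s hs.2]
  rw [goursat, h1, h2]
  simp

end Goursat

/-- Local solvability of the Goursat problem for `∂_ξ ∂_η k = κ k`. -/
theorem exists_goursat (c : ℝ) {f : ℝ → ℂ} (hf : Continuous f) {κ : ℝ → ℝ → ℂ}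
    (hκ : Continuous (Function.uncurry κ)) :
    ∃ d > 0, ∃ φ : ℝ → ℝ → ℂ, Continuous (Function.uncurry φ) ∧
      ((∀ s ≤ c, f s = 0) → ∀ s ≤ c, ∀ t, φ s t = 0) ∧
      ∀ ξ ∈ Icc c (c + d), ∀ η ∈ Icc (-d) d, φ ξ η = κ ξ η * goursat c f φ ξ η := by
  obtain ⟨M, hM⟩ := (isCompact_Icc.prod isCompact_Icc).exists_bound_of_continuousOn
    (s := Icc c (c + 1) ×ˢ Icc (-1 : ℝ) 1) hκ.continuousOn
  have hM0 : 0 ≤ M := (norm_nonneg _).trans (hM (c, 0) (by simp))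
  obtain ⟨Mf, hMf⟩ := isCompact_Icc.exists_bound_of_continuousOn (s := Icc c (c + 1))
    hf.continuousOn
  let d : ℝ := 1 / (M + 2)
  have hd0 : 0 < d := by positivity
  have hd1 : d ≤ 1 := by
    rw [div_le_one (by positivity)]
    linarith
  let K : ℝ := M * d * d
  have hK1 : K < 1 := by
    have h1 : (M + 2) * d = 1 := by simp only [d]; field_simp
    have : M * d < 1 := by nlinarith
    simp only [K]
    have : 0 ≤ M * d := by positivity
    nlinarith
  have hK0 : 0 ≤ K := by positivity
  let m : ℝ → ℝ := fun ξ => max c (min ξ (c + d))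
  let n : ℝ → ℝ := fun η => max (-d) (min η d)
  have hm : ∀ ξ, m ξ ∈ Icc c (c + d) := fun ξ =>
    ⟨le_max_left _ _, max_le (by linarith) (min_le_right _ _)⟩
  have hn : ∀ η, n η ∈ Icc (-d) d := fun η =>
    ⟨le_max_left _ _, max_le (by linarith) (min_le_right _ _)⟩
  have hmc : Continuous m := by fun_prop
  have hnc : Continuous n := by fun_prop
  have hinner : ∀ (ψ : ℝ → ℝ → ℂ) (B : ℝ), 0 ≤ B → (∀ ξ η, ‖ψ ξ η‖ ≤ B) → ∀ ξ η,
      ‖∫ s in c..m ξ, ∫ t in (0:ℝ)..n η, κ s t * ψ s t‖ ≤ K * B := by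
    intro ψ B hB hψ ξ η
    have h1 : ∀ s ∈ uIoc c (m ξ), ‖∫ t in (0:ℝ)..n η, κ s t * ψ s t‖ ≤ M * B * d := by
      intro s hs
      rw [uIoc_of_le (hm ξ).1] at hs
      refine (intervalIntegral.norm_integral_le_of_norm_le_const (C := M * B) fun t ht => ?_).trans ?_
      · rw [norm_mul]
        refine mul_le_mul (hM (s, t) ⟨⟨hs.1.le, ?_⟩, ?_⟩) (hψ s t) (norm_nonneg _) hM0
        · linarith [hs.2, (hm ξ).2]
        · have := uIoc_subset_uIcc ht
          have h0 : uIcc 0 (n η) ⊆ Icc (-1) 1 :=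
            uIcc_subset_Icc (by simp) ⟨by linarith [(hn η).1], by linarith [(hn η).2]⟩
          exact h0 this
      · rw [sub_zero]
        have : |n η| ≤ d := abs_le.2 (hn η)
        gcongr
    refine (norm_integral_le_of_norm_le_const h1).trans ?_
    have : |m ξ - c| ≤ d := by
      rw [abs_of_nonneg (by linarith [(hm ξ).1])]
      linarith [(hm ξ).2]
    calc M * B * d * |m ξ - c| ≤ M * B * d * d := by gcongr
      _ = K * B := by ring
  have hcont : ∀ ψ : BoundedContinuousFunction (ℝ × ℝ) ℂ,
      Continuous (Function.uncurry fun s t => κ s t * ψ (s, t)) := fun ψ =>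
    hκ.mul ψ.continuous
  let S : BoundedContinuousFunction (ℝ × ℝ) ℂ → ℝ × ℝ → ℂ := fun ψ z =>
    goursat c f (fun s t => κ s t * ψ (s, t)) (m z.1) (n z.2)
  have hSc : ∀ ψ, Continuous (S ψ) := fun ψ =>
    (continuous_goursat hf (hcont ψ)).comp
      (by fun_prop : Continuous fun z : ℝ × ℝ => (m z.1, n z.2))
  have hSb : ∀ ψ z, ‖S ψ z‖ ≤ (1 / 2) * (Mf * 1) + K * ‖ψ‖ := by
    intro ψ z
    refine (norm_add_le _ _).trans (add_le_add ?_ (hinner (fun s t => ψ (s, t)) ‖ψ‖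
      (norm_nonneg _) (fun s t => ψ.norm_coe_le_norm _) z.1 z.2))
    rw [norm_mul]
    have h0 : ‖∫ s in c..m z.1, f s‖ ≤ Mf * |m z.1 - c| :=
      norm_integral_le_of_norm_le_const fun s hs => by
        rw [uIoc_of_le (hm _).1] at hs
        exact hMf s ⟨hs.1.le, by linarith [hs.2, (hm z.1).2]⟩
    have h1 : |m z.1 - c| ≤ 1 := by
      rw [abs_of_nonneg (by linarith [(hm z.1).1])]
      linarith [(hm z.1).2]
    have h2 : 0 ≤ Mf := (norm_nonneg _).trans (hMf c (by simp))
    refine mul_le_mul (by norm_num) (h0.trans (by gcongr)) (norm_nonneg _) (by norm_num)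
  let Tm : BoundedContinuousFunction (ℝ × ℝ) ℂ → BoundedContinuousFunction (ℝ × ℝ) ℂ := fun ψ =>
    BoundedContinuousFunction.ofNormedAddCommGroup (S ψ) (hSc ψ) _ (hSb ψ)
  have hT : ContractingWith K.toNNReal Tm := by
    refine ⟨by rwa [← NNReal.coe_lt_coe, Real.coe_toNNReal _ hK0],
      LipschitzWith.of_dist_le_mul fun ψ χ => ?_⟩
    rw [Real.coe_toNNReal _ hK0]
    refine (BoundedContinuousFunction.dist_le (by positivity)).2 fun z => ?_
    have e : S ψ z - S χ z =
        ∫ s in c..m z.1, ∫ t in (0:ℝ)..n z.2, κ s t * (ψ (s, t) - χ (s, t)) := by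
      simp only [S, goursat, add_sub_add_left_eq_sub]
      rw [← intervalIntegral.integral_sub]
      · refine integral_congr fun s _ => ?_
        simp only [mul_sub]
        rw [← intervalIntegral.integral_sub]
        · exact Continuous.intervalIntegrable
            ((hcont ψ).comp (by fun_prop : Continuous fun t : ℝ => (s, t))) _ _
        · exact Continuous.intervalIntegrable
            ((hcont χ).comp (by fun_prop : Continuous fun t : ℝ => (s, t))) _ _
      · exact Continuous.intervalIntegrable ((continuous_integral_snd (hcont ψ)).comp
            (by fun_prop : Continuous fun s : ℝ => (s, n z.2))) _ _
      · exact Continuous.intervalIntegrable ((continuous_integral_snd (hcont χ)).comp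
            (by fun_prop : Continuous fun s : ℝ => (s, n z.2))) _ _
    change dist (S ψ z) (S χ z) ≤ _
    rw [dist_eq_norm, e]
    exact hinner (fun s t => ψ (s, t) - χ (s, t)) _ dist_nonneg
      (fun s t => by rw [← dist_eq_norm]; exact ψ.dist_coe_le_dist _) _ _
  let k := hT.fixedPoint Tm
  have hk : ∀ z, k z = S k z := fun z => by
    have : Tm k = k := hT.fixedPoint_isFixedPt
    conv_lhs => rw [← this]
    rfl
  refine ⟨d, hd0, fun s t => κ s t * k (s, t), hcont k, fun hf0 s hs t => ?_,
    fun ξ hξ η hη => ?_⟩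
  · have : m s = c := max_eq_left ((min_le_left _ _).trans hs)
    change κ s t * k (s, t) = 0
    rw [hk]
    simp only [S, goursat, this, integral_same, mul_zero, add_zero]
  · have h1 : m ξ = ξ := by simp [m, hξ.1, hξ.2]
    have h2 : n η = η := by simp [n, hη.1, hη.2]
    change κ ξ η * k (ξ, η) = _
    rw [hk]
    simp only [S, h1, h2]

section Transform

variable {k k₁ k₂ k₂₁ : ℝ → ℝ → ℂ} {w w₁ w₂ : ℝ → ℂ} {R : ℝ}

theorem integral_characteristic (hk : Continuous (Function.uncurry k))
    (hk₁ : Continuous (Function.uncurry k₁))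
    (hk₂ : Continuous (Function.uncurry k₂))
    (hd₁ : ∀ x y, HasDerivAt (fun x => k x y) (k₁ x y) x)
    (hd₂ : ∀ x y, HasDerivAt (fun y => k x y) (k₂ x y) y) (hw₁ : Continuous w₁)
    (hw : ∀ x, HasDerivAt w (w₁ x) x) {x : ℝ} (h0 : k (x - R) R = 0) :
    ∫ y in (0:ℝ)..R, (k₂ (x - y) y - k₁ (x - y) y) * w (x - 2 * y) =
      (∫ y in (0:ℝ)..R, 2 * (k (x - y) y * w₁ (x - 2 * y))) - k x 0 * w x := by
  have hwc : Continuous w := continuous_iff_continuousAt.2 fun x => (hw x).continuousAt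
  have hl : Continuous fun y : ℝ => (x - y, y) := by fun_prop
  have c0 : Continuous fun y => k (x - y) y := hk.comp hl
  have c1 : Continuous fun y => k₁ (x - y) y := hk₁.comp hl
  have c2 : Continuous fun y => k₂ (x - y) y := hk₂.comp hl
  have key := integral_eq_sub_of_hasDerivAt (a := 0) (b := R)
    (f := fun y => k (x - y) y * w (x - 2 * y))
    (f' := fun y => (k₂ (x - y) y - k₁ (x - y) y) * w (x - 2 * y) -
      2 * (k (x - y) y * w₁ (x - 2 * y)))
    (fun y _ => by
      have h2 : HasDerivAt (fun y : ℝ => x - 2 * y) (-2) y := by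
        simpa using ((hasDerivAt_id y).const_mul 2).const_sub x
      have h3 := (hw (x - 2 * y)).scomp y h2
      refine ((hasDerivAt_characteristic hk₁ hk₂ hd₁ hd₂ x y).mul h3).congr_deriv ?_
      simp only [Function.comp_apply, Complex.real_smul]
      push_cast
      ring)
    (Continuous.intervalIntegrable (by fun_prop) _ _)
  rw [intervalIntegral.integral_sub (Continuous.intervalIntegrable (by fun_prop) _ _)
    (Continuous.intervalIntegrable (by fun_prop) _ _)] at key
  simp only [h0, sub_zero, mul_zero, zero_mul, zero_sub] at key
  linear_combination key

theorem hasDerivAt_transform (hk : Continuous (Function.uncurry k))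
    (hk₁ : Continuous (Function.uncurry k₁))
    (hk₂ : Continuous (Function.uncurry k₂))
    (hd₁ : ∀ x y, HasDerivAt (fun x => k x y) (k₁ x y) x)
    (hd₂ : ∀ x y, HasDerivAt (fun y => k x y) (k₂ x y) y) (hw₁ : Continuous w₁)
    (hw : ∀ x, HasDerivAt w (w₁ x) x) {x : ℝ} (h0 : k (x - R) R = 0) :
    HasDerivAt (fun x => ∫ y in (0:ℝ)..R, k (x - y) y * w (x - 2 * y))
      (k x 0 * w x + ∫ y in (0:ℝ)..R,
        (k₂ (x - y) y * w (x - 2 * y) - k (x - y) y * w₁ (x - 2 * y))) x := by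
  have hwc : Continuous w := continuous_iff_continuousAt.2 fun x => (hw x).continuousAt
  have hl : Continuous fun z : ℝ × ℝ => (z.1 - z.2, z.2) := by fun_prop
  have c0 : Continuous fun z : ℝ × ℝ => k (z.1 - z.2) z.2 := hk.comp hl
  have c1 : Continuous fun z : ℝ × ℝ => k₁ (z.1 - z.2) z.2 := hk₁.comp hl
  have hlx : Continuous fun y : ℝ => (x - y, y) := by fun_prop
  have c0x : Continuous fun y => k (x - y) y := hk.comp hlx
  have c1x : Continuous fun y => k₁ (x - y) y := hk₁.comp hlx
  have c2x : Continuous fun y => k₂ (x - y) y := hk₂.comp hlx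
  have h := hasDerivAt_integral_param (Φ := fun x y => k (x - y) y * w (x - 2 * y))
    (Φ' := fun x y => k₁ (x - y) y * w (x - 2 * y) + k (x - y) y * w₁ (x - 2 * y))
    (by simp only [Function.uncurry_def]; fun_prop)
    (by simp only [Function.uncurry_def]; fun_prop)
    (fun x y => ((hd₁ (x - y) y).comp_sub_const x y).mul
      ((hw (x - 2 * y)).comp_sub_const x (2 * y))) 0 R x
  refine h.congr_deriv ?_
  have e := integral_characteristic hk hk₁ hk₂ hd₁ hd₂ hw₁ hw h0
  have e' : ∫ y in (0:ℝ)..R, (k₁ (x - y) y * w (x - 2 * y) + k (x - y) y * w₁ (x - 2 * y)) =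
      (∫ y in (0:ℝ)..R, (k₂ (x - y) y * w (x - 2 * y) - k (x - y) y * w₁ (x - 2 * y))) +
      ((∫ y in (0:ℝ)..R, 2 * (k (x - y) y * w₁ (x - 2 * y))) -
        ∫ y in (0:ℝ)..R, (k₂ (x - y) y - k₁ (x - y) y) * w (x - 2 * y)) := by
    rw [← intervalIntegral.integral_sub (Continuous.intervalIntegrable (by fun_prop) _ _)
      (Continuous.intervalIntegrable (by fun_prop) _ _), ← intervalIntegral.integral_add
      (Continuous.intervalIntegrable (by fun_prop) _ _)
      (Continuous.intervalIntegrable (by fun_prop) _ _)]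
    refine integral_congr fun y _ => ?_
    ring
  rw [e', e]
  ring

theorem hasDerivAt_transform_deriv (hk : Continuous (Function.uncurry k))
    (hk₁ : Continuous (Function.uncurry k₁))
    (hk₂ : Continuous (Function.uncurry k₂)) (hk₂₁ : Continuous (Function.uncurry k₂₁))
    (hd₁ : ∀ x y, HasDerivAt (fun x => k x y) (k₁ x y) x)
    (hd₂ : ∀ x y, HasDerivAt (fun y => k x y) (k₂ x y) y)
    (hd₂₁ : ∀ x y, HasDerivAt (fun x => k₂ x y) (k₂₁ x y) x) (hw₂ : Continuous w₂)
    (hw : ∀ x, HasDerivAt w (w₁ x) x) (hw' : ∀ x, HasDerivAt w₁ (w₂ x) x)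
    {x : ℝ} (h0 : k (x - R) R = 0) :
    HasDerivAt (fun x => k x 0 * w x + ∫ y in (0:ℝ)..R,
        (k₂ (x - y) y * w (x - 2 * y) - k (x - y) y * w₁ (x - 2 * y)))
      (k₁ x 0 * w x + ∫ y in (0:ℝ)..R,
        (k₂₁ (x - y) y * w (x - 2 * y) + k (x - y) y * w₂ (x - 2 * y))) x := by
  have hwc : Continuous w := continuous_iff_continuousAt.2 fun x => (hw x).continuousAt
  have hwc₁ : Continuous w₁ := continuous_iff_continuousAt.2 fun x => (hw' x).continuousAt
  have hl : Continuous fun z : ℝ × ℝ => (z.1 - z.2, z.2) := by fun_prop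
  have c0 : Continuous fun z : ℝ × ℝ => k (z.1 - z.2) z.2 := hk.comp hl
  have c1 : Continuous fun z : ℝ × ℝ => k₁ (z.1 - z.2) z.2 := hk₁.comp hl
  have c2 : Continuous fun z : ℝ × ℝ => k₂ (z.1 - z.2) z.2 := hk₂.comp hl
  have c21 : Continuous fun z : ℝ × ℝ => k₂₁ (z.1 - z.2) z.2 := hk₂₁.comp hl
  have hlx : Continuous fun y : ℝ => (x - y, y) := by fun_prop
  have c0x : Continuous fun y => k (x - y) y := hk.comp hlx
  have c1x : Continuous fun y => k₁ (x - y) y := hk₁.comp hlx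
  have c2x : Continuous fun y => k₂ (x - y) y := hk₂.comp hlx
  have c21x : Continuous fun y => k₂₁ (x - y) y := hk₂₁.comp hlx
  have h := hasDerivAt_integral_param
    (Φ := fun x y => k₂ (x - y) y * w (x - 2 * y) - k (x - y) y * w₁ (x - 2 * y))
    (Φ' := fun x y => (k₂₁ (x - y) y * w (x - 2 * y) + k₂ (x - y) y * w₁ (x - 2 * y)) -
      (k₁ (x - y) y * w₁ (x - 2 * y) + k (x - y) y * w₂ (x - 2 * y)))
    (by simp only [Function.uncurry_def]; fun_prop)
    (by simp only [Function.uncurry_def]; fun_prop)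
    (fun x y => (((hd₂₁ (x - y) y).comp_sub_const x y).mul
      ((hw (x - 2 * y)).comp_sub_const x (2 * y))).sub
      (((hd₁ (x - y) y).comp_sub_const x y).mul
      ((hw' (x - 2 * y)).comp_sub_const x (2 * y)))) 0 R x
  refine (((hd₁ x 0).mul (hw x)).add h).congr_deriv ?_
  have e := integral_characteristic hk hk₁ hk₂ hd₁ hd₂ hw₂ hw' h0
  have e' : ∫ y in (0:ℝ)..R, ((k₂₁ (x - y) y * w (x - 2 * y) + k₂ (x - y) y * w₁ (x - 2 * y)) -
      (k₁ (x - y) y * w₁ (x - 2 * y) + k (x - y) y * w₂ (x - 2 * y))) =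
      (∫ y in (0:ℝ)..R,
        (k₂₁ (x - y) y * w (x - 2 * y) + k (x - y) y * w₂ (x - 2 * y))) +
      ((∫ y in (0:ℝ)..R, (k₂ (x - y) y - k₁ (x - y) y) * w₁ (x - 2 * y)) -
        ∫ y in (0:ℝ)..R, 2 * (k (x - y) y * w₂ (x - 2 * y))) := by
    rw [← intervalIntegral.integral_sub (Continuous.intervalIntegrable (by fun_prop) _ _)
      (Continuous.intervalIntegrable (by fun_prop) _ _), ← intervalIntegral.integral_add
      (Continuous.intervalIntegrable (by fun_prop) _ _)
      (Continuous.intervalIntegrable (by fun_prop) _ _)]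
    refine integral_congr fun y _ => ?_
    ring
  rw [e', e]
  ring

end Transform

/-- Extension to the line of a `C¹` function whose derivative has been extended. -/
theorem exists_extension_of_hasDerivWithinAt {E : Type*} [NormedAddCommGroup E] [NormedSpace ℝ E]
    [CompleteSpace E] {a b : ℝ} {g g₁ G₁ : ℝ → E}
    (hg : ∀ x ∈ Icc a b, HasDerivWithinAt g (g₁ x) (Icc a b) x) (hG₁ : Continuous G₁)
    (heq : ∀ x ∈ Icc a b, G₁ x = g₁ x) :
    ∃ G : ℝ → E, (∀ x, HasDerivAt G (G₁ x) x) ∧ ∀ x ∈ Icc a b, G x = g x := by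
  refine ⟨fun x => g a + ∫ y in a..x, G₁ y, fun x =>
    (hG₁.integral_hasStrictDerivAt a x).hasDerivAt.const_add _, fun x hx => ?_⟩
  have hsub : Icc a x ⊆ Icc a b := Icc_subset_Icc_right hx.2
  have := integral_eq_sub_of_hasDerivAt_of_le (f := g) (f' := G₁) hx.1
    (fun y hy => ((hg y (hsub hy)).mono hsub).continuousWithinAt) (fun y hy => by
      rw [heq y (hsub (Ioo_subset_Icc_self hy))]
      exact (hg y (hsub (Ioo_subset_Icc_self hy))).hasDerivAt
        (Icc_mem_nhds hy.1 (hy.2.trans_le hx.2)))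
    (hG₁.intervalIntegrable _ _)
  simp [this]

theorem exists_continuous_extension {E : Type*} [TopologicalSpace E] {a b : ℝ} (hab : a ≤ b)
    {g : ℝ → E} (hg : ContinuousOn g (Icc a b)) :
    ∃ G : ℝ → E, Continuous G ∧ ∀ x ∈ Icc a b, G x = g x :=
  ⟨IccExtend hab (domRestrict (Icc a b) g), hg.domRestrict.Icc_extend', fun x hx => by
    rw [IccExtend_of_mem _ _ hx]; rfl⟩

theorem exists_extension_of_contDiffOn {E : Type*} [NormedAddCommGroup E] [NormedSpace ℝ E]
    [CompleteSpace E] {a b : ℝ} (hab : a < b) {g : ℝ → E} (hg : ContDiffOn ℝ 1 g (Icc a b)) :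
    ∃ G G₁ : ℝ → E, Continuous G₁ ∧ (∀ x, HasDerivAt G (G₁ x) x) ∧ (∀ x ∈ Icc a b, G x = g x) ∧
      ∀ x ∈ Icc a b, G₁ x = derivWithin g (Icc a b) x := by
  obtain ⟨G₁, hG₁, eG₁⟩ := exists_continuous_extension hab.le
    (hg.continuousOn_derivWithin (uniqueDiffOn_Icc hab) le_rfl)
  obtain ⟨G, hG, eG⟩ := exists_extension_of_hasDerivWithinAt (fun x hx =>
    ((hg.differentiableOn one_ne_zero) x hx).hasDerivWithinAt) hG₁ eG₁
  exact ⟨G, G₁, hG₁, hG, eG, eG₁⟩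

theorem forcing_eq_zero_of_hasDerivAt {X T C : ℝ} (hX : 0 < X) (hT : 0 < T) {σ : ℂ}
    {q A U : ℝ → ℂ} (hq : ContinuousOn q (Icc 0 X)) (hA : ContinuousOn A (Icc 0 X))
    (hU : ContinuousOn U (Icc 0 X)) {Z Z₁ : ℂ → ℝ → ℂ}
    (hZ : ∀ s : ℂ, 0 ≤ s.re → ContinuousOn (Z s) (Icc 0 X))
    (hZ₁ : ∀ s : ℂ, 0 ≤ s.re → ContinuousOn (Z₁ s) (Icc 0 X))
    (hd : ∀ s : ℂ, 0 ≤ s.re → ∀ x ∈ Ioo 0 X, HasDerivAt (Z s) (Z₁ s x) x)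
    (hd₁ : ∀ s : ℂ, 0 ≤ s.re → ∀ x ∈ Ioo 0 X, HasDerivAt (Z₁ s)
      ((-σ * s + q x) * Z s x + (A x - Complex.exp (-s * T) * U x)) x)
    (h0 : ∀ s : ℂ, 0 ≤ s.re → Z s 0 = 0) (h0₁ : ∀ s : ℂ, 0 ≤ s.re → Z₁ s 0 = 0)
    (hb : ∀ s : ℂ, 0 ≤ s.re → ∀ x ∈ Icc 0 X, ‖Z s x‖ ≤ C / (1 + s.re)) :
    ∀ x ∈ Icc 0 X, A x = 0 := by
  obtain ⟨q', hq', eq⟩ := exists_continuous_extension hX.le hq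
  obtain ⟨A', hA', eA⟩ := exists_continuous_extension hX.le hA
  obtain ⟨U', hU', eU⟩ := exists_continuous_extension hX.le hU
  have hex : ∀ s : ℂ, ∃ Z' : ℝ → ℂ, 0 ≤ s.re → Continuous Z' ∧ ∀ x ∈ Icc 0 X, Z' x = Z s x :=
    fun s => by
      by_cases hs : 0 ≤ s.re
      · obtain ⟨Z', h⟩ := exists_continuous_extension hX.le (hZ s hs)
        exact ⟨Z', fun _ => h⟩
      · exact ⟨0, fun h => absurd h hs⟩
  choose Z' hZ' using hex
  have := forcing_eq_zero (σ := σ) (C := C) hX hT hq' hA' hU' (Z := Z') (fun s hs => (hZ' s hs).1)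
    (fun s hs x hx => by
      rw [(hZ' s hs).2 x hx, eq_secondPrimitive (hZ s hs) (hZ₁ s hs) (by
        have := hZ s hs
        fun_prop) (hd s hs) (hd₁ s hs) (h0 s hs) (h0₁ s hs) hx]
      refine secondPrimitive_congr hx.1 fun y hy => ?_
      have hy' : y ∈ Icc 0 X := ⟨hy.1, hy.2.trans hx.2⟩
      rw [eq y hy', eA y hy', eU y hy', (hZ' s hs).2 y hy'])
    (fun s hs x hx => by rw [(hZ' s hs).2 x hx]; exact hb s hs x hx)
  exact fun x hx => by rw [← eA x hx]; exact this x hx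

theorem integral_fst_eq_zero {c ξ : ℝ} {φ : ℝ → ℝ → ℂ} (hφ : ∀ s ≤ c, ∀ t, φ s t = 0)
    (hξ : ξ ≤ c) (η : ℝ) : ∫ s in c..ξ, φ s η = 0 := by
  rw [← integral_zero (a := c) (b := ξ)]
  refine integral_congr fun s hs => ?_
  rw [uIcc_of_ge hξ] at hs
  exact hφ s hs.2 η

theorem norm_goursat_le {c r M N : ℝ} {f : ℝ → ℂ} {φ : ℝ → ℝ → ℂ} (hf : Continuous f)
    (hφ : Continuous (Function.uncurry φ)) (hr : 0 ≤ r) (hr1 : r ≤ 1) (hM0 : 0 ≤ M)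
    (hM : M * r ≤ 1 / 16)
    (hφM : ∀ ξ ∈ Icc c (c + r), ∀ η ∈ Icc 0 r, ‖φ ξ η‖ ≤ M * ‖goursat c f φ ξ η‖)
    (hF : ∀ ξ ∈ Icc c (c + r), ‖∫ s in c..ξ, f s‖ ≤ N * (ξ - c)) (hN : 0 ≤ N) :
    ∀ ξ ∈ Icc c (c + r), ∀ η ∈ Icc 0 r, ‖goursat c f φ ξ η‖ ≤ 9 / 16 * N * (ξ - c) ∧
      ‖∫ s in c..ξ, φ s η‖ ≤ 1 / 16 * N * (ξ - c) := by
  obtain ⟨⟨ξ₀, η₀⟩, ⟨hξ₀, hη₀⟩, hmax⟩ := (isCompact_Icc.prod isCompact_Icc).exists_isMaxOn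
    (s := Icc c (c + r) ×ˢ Icc (0:ℝ) r) ⟨(c, 0), by simp [hr]⟩
    (continuous_goursat (c := c) hf hφ).norm.continuousOn
  set m := ‖goursat c f φ ξ₀ η₀‖ with hm
  have hmb : ∀ ξ ∈ Icc c (c + r), ∀ η ∈ Icc 0 r, ‖goursat c f φ ξ η‖ ≤ m :=
    fun ξ hξ η hη => hmax (a := (ξ, η)) ⟨hξ, hη⟩
  have hφm : ∀ ξ ∈ Icc c (c + r), ∀ η ∈ Icc 0 r, ‖φ ξ η‖ ≤ M * m := fun ξ hξ η hη =>
    (hφM ξ hξ η hη).trans (mul_le_mul_of_nonneg_left (hmb ξ hξ η hη) hM0)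
  have hm0 : 0 ≤ m := norm_nonneg _
  have hk : ∀ ξ ∈ Icc c (c + r), ∀ η ∈ Icc 0 r,
      ‖goursat c f φ ξ η‖ ≤ (1 / 2 * N + 1 / 16 * m) * (ξ - c) := by
    intro ξ hξ η hη
    have hξ0 : 0 ≤ ξ - c := by linarith [hξ.1]
    have h1 : ‖∫ s in c..ξ, ∫ t in (0:ℝ)..η, φ s t‖ ≤ (M * m * r) * |ξ - c| := by
      refine intervalIntegral.norm_integral_le_of_norm_le_const fun s hs => ?_
      rw [uIoc_of_le hξ.1] at hs
      refine (intervalIntegral.norm_integral_le_of_norm_le_const (C := M * m)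
        fun t ht => ?_).trans ?_
      · rw [uIoc_of_le hη.1] at ht
        exact hφm s ⟨hs.1.le, hs.2.trans hξ.2⟩ t ⟨ht.1.le, ht.2.trans hη.2⟩
      · rw [sub_zero, abs_of_nonneg hη.1]
        exact mul_le_mul_of_nonneg_left hη.2 (by positivity)
    rw [abs_of_nonneg hξ0] at h1
    have h2 : M * m * r ≤ 1 / 16 * m := by nlinarith
    calc ‖goursat c f φ ξ η‖ ≤ _ := norm_add_le _ _
      _ ≤ 1 / 2 * (N * (ξ - c)) + (1 / 16 * m) * (ξ - c) := by
        refine add_le_add ?_ (h1.trans (mul_le_mul_of_nonneg_right h2 hξ0))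
        rw [norm_mul]
        exact mul_le_mul (by norm_num) (hF ξ hξ) (norm_nonneg _) (by norm_num)
      _ = _ := by ring
  have hmN : m ≤ N * r := by
    have h1 := hk ξ₀ hξ₀ η₀ hη₀
    have h2 : (1 / 2 * N + 1 / 16 * m) * (ξ₀ - c) ≤ (1 / 2 * N + 1 / 16 * m) * r :=
      mul_le_mul_of_nonneg_left (by linarith [hξ₀.2]) (by positivity)
    rw [← hm] at h1
    nlinarith [mul_nonneg hN hr, mul_nonneg hm0 hr, mul_nonneg hm0 (sub_nonneg.2 hr1)]
  intro ξ hξ η hη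
  have hξ0 : 0 ≤ ξ - c := by linarith [hξ.1]
  constructor
  · refine (hk ξ hξ η hη).trans (mul_le_mul_of_nonneg_right ?_ hξ0)
    nlinarith
  · have h1 : ‖∫ s in c..ξ, φ s η‖ ≤ (M * m) * |ξ - c| := by
      refine intervalIntegral.norm_integral_le_of_norm_le_const fun s hs => ?_
      rw [uIoc_of_le hξ.1] at hs
      exact hφm s ⟨hs.1.le, hs.2.trans hξ.2⟩ η hη
    rw [abs_of_nonneg hξ0] at h1
    refine h1.trans (mul_le_mul_of_nonneg_right ?_ hξ0)
    nlinarith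

/-- Near a zero of order at most one, `(x - c) ‖β'‖ ≲ ‖β‖` with a constant close to `1`. -/
theorem exists_radius {c r₁ : ℝ} (hr₁ : 0 < r₁) {β β₁ : ℝ → ℂ} (hβ₁ : Continuous β₁)
    (hβ : ∀ x, HasDerivAt β (β₁ x) x) (h0 : β c = 0 → β₁ c ≠ 0) :
    ∃ r > 0, r ≤ r₁ ∧ ∃ S₀ S₁ : ℝ, (∀ y ∈ Icc (c - r) (c + r), ‖β y‖ ≤ S₀ ∧ ‖β₁ y‖ ≤ S₁) ∧
      ∀ x ∈ Ioc c (c + r), 0 < ‖β x‖ ∧ (x - c) * (1 / 16 * S₀ + 9 / 16 * S₁) ≤ 3 / 4 * ‖β x‖ := by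
  have hβc : Continuous β := continuous_iff_continuousAt.2 fun x => (hβ x).continuousAt
  by_cases hc : β c = 0
  · have hb : 0 < ‖β₁ c‖ := norm_pos_iff.2 (h0 hc)
    set b := ‖β₁ c‖
    have e1 : ∀ᶠ y in nhds c, ‖β y‖ < b :=
      hβc.norm.continuousAt.eventually_lt continuousAt_const (by simpa [hc] using hb)
    have e2 : ∀ᶠ y in nhds c, ‖β₁ y‖ < 17 / 16 * b :=
      hβ₁.norm.continuousAt.eventually_lt continuousAt_const (by linarith)
    have e3 : ∀ᶠ y in nhds c, ‖β y - β c - (y - c) • β₁ c‖ ≤ b / 16 * ‖y - c‖ :=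
      (hasDerivAt_iff_isLittleO.1 (hβ c)).def (by positivity)
    obtain ⟨δ, hδ, h⟩ := Metric.eventually_nhds_iff_ball.1 (e1.and (e2.and e3))
    refine ⟨min r₁ (δ / 2), by positivity, min_le_left _ _, b, 17 / 16 * b, fun y hy => ?_,
      fun x hx => ?_⟩
    · have hy' : y ∈ Metric.ball c δ := by
        rw [Real.ball_eq_Ioo]
        have := min_le_right r₁ (δ / 2)
        exact ⟨by linarith [hy.1], by linarith [hy.2]⟩
      exact ⟨(h y hy').1.le, (h y hy').2.1.le⟩
    · have hx' : x ∈ Metric.ball c δ := by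
        rw [Real.ball_eq_Ioo]
        have := min_le_right r₁ (δ / 2)
        exact ⟨by linarith [hx.1], by linarith [hx.2]⟩
      have h3 := (h x hx').2.2
      have hxc : 0 < x - c := by linarith [hx.1]
      rw [hc, sub_zero, Real.norm_of_nonneg hxc.le] at h3
      have h4 : ‖(x - c) • β₁ c‖ = (x - c) * b := by
        rw [norm_smul, Real.norm_of_nonneg hxc.le]
      have h5 := norm_sub_norm_le ((x - c) • β₁ c) (β x)
      rw [h4, norm_sub_rev] at h5
      have h6 : 0 < (x - c) * b := by positivity
      constructor <;> nlinarith
  · have hb : 0 < ‖β c‖ := norm_pos_iff.2 hc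
    set b := ‖β c‖
    set b₁ := ‖β₁ c‖
    have hb₁ : 0 ≤ b₁ := norm_nonneg _
    have e1 : ∀ᶠ y in nhds c, ‖β y‖ < 2 * b :=
      hβc.norm.continuousAt.eventually_lt continuousAt_const (by linarith)
    have e2 : ∀ᶠ y in nhds c, ‖β₁ y‖ < b₁ + 1 :=
      hβ₁.norm.continuousAt.eventually_lt continuousAt_const (by linarith)
    have e3 : ∀ᶠ y in nhds c, 1 / 2 * b < ‖β y‖ :=
      continuousAt_const.eventually_lt hβc.norm.continuousAt (by linarith)
    obtain ⟨δ, hδ, h⟩ := Metric.eventually_nhds_iff_ball.1 (e1.and (e2.and e3))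
    let D : ℝ := 1 / 16 * (2 * b) + 9 / 16 * (b₁ + 1)
    have hD : 0 < D := by positivity
    refine ⟨min r₁ (min (δ / 2) (3 / 8 * b / D)), by positivity, min_le_left _ _, 2 * b, b₁ + 1,
      fun y hy => ?_, fun x hx => ?_⟩
    · have hy' : y ∈ Metric.ball c δ := by
        rw [Real.ball_eq_Ioo]
        have := (min_le_right r₁ (min (δ / 2) (3 / 8 * b / D))).trans (min_le_left _ _)
        exact ⟨by linarith [hy.1], by linarith [hy.2]⟩
      exact ⟨(h y hy').1.le, (h y hy').2.1.le⟩
    · have hx' : x ∈ Metric.ball c δ := by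
        rw [Real.ball_eq_Ioo]
        have := (min_le_right r₁ (min (δ / 2) (3 / 8 * b / D))).trans (min_le_left _ _)
        exact ⟨by linarith [hx.1], by linarith [hx.2]⟩
      have h3 := (h x hx').2.2
      have hxD : x - c ≤ 3 / 8 * b / D := by
        have := (min_le_right r₁ (min (δ / 2) (3 / 8 * b / D))).trans (min_le_right _ _)
        linarith [hx.2]
      rw [le_div_iff₀ hD] at hxD
      exact ⟨by linarith, by change (x - c) * D ≤ _; linarith⟩

/-- Uniqueness for the Volterra equation satisfied by the primitive of `f`. -/
theorem integral_eq_zero_of_volterra {c r R M S₀ S₁ : ℝ} {f β β₁ : ℝ → ℂ} {φ : ℝ → ℝ → ℂ}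
    (hf : Continuous f) (hφ : Continuous (Function.uncurry φ)) (hβ : Continuous β)
    (hβ₁ : Continuous β₁) (hf0 : ∀ s ≤ c, f s = 0) (hφ0 : ∀ s ≤ c, ∀ t, φ s t = 0)
    (hr : 0 < r) (hr1 : r ≤ 1) (hrR : r ≤ R) (hM0 : 0 ≤ M) (hM : M * r ≤ 1 / 16)
    (hφM : ∀ ξ ∈ Icc c (c + r), ∀ η ∈ Icc 0 r, ‖φ ξ η‖ ≤ M * ‖goursat c f φ ξ η‖)
    (hS : ∀ y ∈ Icc (c - r) (c + r), ‖β y‖ ≤ S₀ ∧ ‖β₁ y‖ ≤ S₁)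
    (hSβ : ∀ x ∈ Ioc c (c + r),
      0 < ‖β x‖ ∧ (x - c) * (1 / 16 * S₀ + 9 / 16 * S₁) ≤ 3 / 4 * ‖β x‖)
    (heq : ∀ x ∈ Ioc c (c + r), goursat c f φ x 0 * β x + ∫ y in (0:ℝ)..R,
        ((∫ s in c..(x - y), φ s y) * β (x - 2 * y) -
          goursat c f φ (x - y) y * β₁ (x - 2 * y)) = 0) :
    ∀ x ∈ Icc c (c + r), ∫ s in c..x, f s = 0 := by
  have step : ∀ N : ℝ, 0 ≤ N → (∀ ξ ∈ Icc c (c + r), ‖∫ s in c..ξ, f s‖ ≤ N * (ξ - c)) →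
      ∀ ξ ∈ Icc c (c + r), ‖∫ s in c..ξ, f s‖ ≤ (3 / 4 * N) * (ξ - c) := by
    intro N hN hF x hx
    rcases hx.1.eq_or_lt with rfl | hcx
    · simp
    have hb := norm_goursat_le hf hφ hr.le hr1 hM0 hM hφM hF hN
    have hx' : x ∈ Ioc c (c + r) := ⟨hcx, hx.2⟩
    have hint : Continuous fun y => (∫ s in c..(x - y), φ s y) * β (x - 2 * y) -
          goursat c f φ (x - y) y * β₁ (x - 2 * y) := by
      have hl : Continuous fun y : ℝ => (x - y, y) := by fun_prop
      have c0 : Continuous fun y => goursat c f φ (x - y) y := (continuous_goursat hf hφ).comp hl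
      have c1 : Continuous fun y => ∫ s in c..(x - y), φ s y := (continuous_integral_fst hφ).comp hl
      fun_prop
    have e := heq x hx'
    have hsplit := integral_add_adjacent_intervals
      (hint.intervalIntegrable (μ := volume) 0 (x - c)) (hint.intervalIntegrable (x - c) R)
    have hz : ∫ y in (x - c)..R, ((∫ s in c..(x - y), φ s y) * β (x - 2 * y) -
          goursat c f φ (x - y) y * β₁ (x - 2 * y)) = 0 := by
      rw [← integral_zero (a := x - c) (b := R)]
      refine integral_congr fun y hy => ?_
      rw [uIcc_of_le (by linarith [hx.2])] at hy
      have hy' : x - y ≤ c := by linarith [hy.1]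
      simp only [goursat_eq_zero hf0 hφ0 hy', integral_fst_eq_zero hφ0 hy', zero_mul, sub_zero]
    rw [hz, add_zero] at hsplit
    rw [← hsplit] at e
    have hle : ‖∫ y in (0:ℝ)..(x - c), ((∫ s in c..(x - y), φ s y) * β (x - 2 * y) -
          goursat c f φ (x - y) y * β₁ (x - 2 * y))‖ ≤
        ∫ y in (0:ℝ)..(x - c), N * (1 / 16 * S₀ + 9 / 16 * S₁) * ((x - c) - y) := by
      refine norm_integral_le_of_norm_le (by linarith) (ae_of_all _ fun y hy => ?_)
        (Continuous.intervalIntegrable (by fun_prop) _ _)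
      have hy1 : x - y ∈ Icc c (c + r) := ⟨by linarith [hy.2], by linarith [hy.1, hx.2]⟩
      have hy2 : y ∈ Icc 0 r := ⟨hy.1.le, by linarith [hy.2, hx.2]⟩
      have hy3 := hS (x - 2 * y) ⟨by linarith [hy.2, hx.2], by linarith [hy.1, hx.2]⟩
      obtain ⟨h1, h2⟩ := hb _ hy1 _ hy2
      have h3 : 0 ≤ x - y - c := by linarith [hy1.1]
      refine (norm_sub_le _ _).trans ?_
      rw [norm_mul, norm_mul]
      calc _ ≤ 1 / 16 * N * (x - y - c) * S₀ + 9 / 16 * N * (x - y - c) * S₁ := by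
            refine add_le_add (mul_le_mul h2 hy3.1 (norm_nonneg _) (by positivity))
              (mul_le_mul h1 hy3.2 (norm_nonneg _) (by positivity))
        _ = _ := by ring
    have hI : ∫ y in (0:ℝ)..(x - c), N * (1 / 16 * S₀ + 9 / 16 * S₁) * ((x - c) - y) =
        N * (1 / 16 * S₀ + 9 / 16 * S₁) * ((x - c) ^ 2 / 2) := by
      rw [intervalIntegral.integral_const_mul, intervalIntegral.integral_sub (by simp) (by simp),
        integral_id, intervalIntegral.integral_const, smul_eq_mul]
      ring
    have hk0 : goursat c f φ x 0 = (1 / 2) * ∫ s in c..x, f s := by simp [goursat]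
    rw [hk0] at e
    have e2 := congrArg norm (eq_neg_of_add_eq_zero_left e)
    rw [norm_neg, norm_mul, norm_mul] at e2
    rw [hI, ← e2] at hle
    obtain ⟨hβ0, hβ2⟩ := hSβ x hx'
    have h12 : ‖(1 / 2 : ℂ)‖ = 1 / 2 := by norm_num
    rw [h12] at hle
    have hxc : 0 ≤ N * (x - c) := mul_nonneg hN (by linarith)
    have := mul_le_mul_of_nonneg_left hβ2 hxc
    refine le_of_mul_le_mul_right ?_ hβ0
    nlinarith
  obtain ⟨N, hN⟩ := isCompact_Icc.exists_bound_of_continuousOn (s := Icc c (c + r))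
    hf.continuousOn
  have hN0 : 0 ≤ N := (norm_nonneg _).trans (hN c (by simp [hr.le]))
  have hall : ∀ n : ℕ, ∀ ξ ∈ Icc c (c + r),
      ‖∫ s in c..ξ, f s‖ ≤ ((3 / 4) ^ n * N) * (ξ - c) := by
    intro n
    induction n with
    | zero =>
      intro ξ hξ
      have := intervalIntegral.norm_integral_le_of_norm_le_const (a := c) (b := ξ) (f := f)
        (C := N) fun s hs => by
          rw [uIoc_of_le hξ.1] at hs
          exact hN s ⟨hs.1.le, hs.2.trans hξ.2⟩
      rw [abs_of_nonneg (by linarith [hξ.1])] at this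
      simpa using this
    | succ n ih =>
      have := step _ (by positivity) ih
      simpa only [pow_succ', mul_assoc] using this
  intro x hx
  have ht : Filter.Tendsto (fun n : ℕ => ((3 / 4 : ℝ) ^ n * N) * (x - c)) Filter.atTop (nhds 0) := by
    have := ((tendsto_pow_atTop_nhds_zero_of_lt_one (r := (3 / 4 : ℝ)) (by norm_num)
      (by norm_num)).mul_const N).mul_const (x - c)
    simpa using this
  exact norm_le_zero_iff.1 (ge_of_tendsto' ht fun n => hall n x hx)

/-- The transformation operator with Goursat kernel applied to a solution `g` of
`g'' = (lam + P) g + H` solves `I'' = (lam + Q) I + f g + 2 ∫ k H`. -/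
theorem exists_transform {c R K D : ℝ} {lam : ℂ} {f P Q g g₁ H : ℝ → ℂ} {φ : ℝ → ℝ → ℂ}
    (hR : 0 < R) (hf : Continuous f) (hφ : Continuous (Function.uncurry φ))
    (hf0 : ∀ s ≤ c, f s = 0) (hφ0 : ∀ s ≤ c, ∀ t, φ s t = 0)
    (hφκ : ∀ ξ ∈ Icc c (c + R), ∀ η ∈ Icc 0 R,
      φ ξ η = (Q (ξ + η) - P (ξ - η)) * goursat c f φ ξ η)
    (hK : ∀ ξ ∈ Icc c (c + R), ∀ η ∈ Icc 0 R, ‖goursat c f φ ξ η‖ ≤ K)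
    (hP : Continuous P) (hH : Continuous H)
    (hg : ∀ y ∈ Icc (c - R) (c + R), HasDerivAt g (g₁ y) y)
    (hg₁ : ∀ y ∈ Icc (c - R) (c + R), HasDerivAt g₁ ((lam + P y) * g y + H y) y)
    (hD : ∀ y ∈ Icc (c - R) (c + R), ‖g y‖ ≤ D) :
    ∃ I I₁ : ℝ → ℂ, (∀ x ≤ c + R, HasDerivAt I (I₁ x) x) ∧
      (∀ x ≤ c + R, HasDerivAt I₁ (f x * g x + (lam + Q x) * I x +
        2 * ∫ y in (0:ℝ)..R, goursat c f φ (x - y) y * H (x - 2 * y)) x) ∧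
      (∀ x ≤ c, I x = 0 ∧ I₁ x = 0) ∧ ∀ x ≤ c + R, ‖I x‖ ≤ 2 * (K * D * R) := by
  have hW : c - R ≤ c + R := by linarith
  have hgc : ContinuousOn g (Icc (c - R) (c + R)) := fun y hy =>
    (hg y hy).continuousAt.continuousWithinAt
  obtain ⟨G₂, hG₂, eG₂⟩ := exists_continuous_extension hW
    (g := fun y => (lam + P y) * g y + H y) (by fun_prop)
  obtain ⟨G₁, hG₁, eG₁⟩ := exists_extension_of_hasDerivWithinAt
    (fun y hy => (hg₁ y hy).hasDerivWithinAt) hG₂ eG₂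
  have hG₁c : Continuous G₁ := continuous_iff_continuousAt.2 fun x => (hG₁ x).continuousAt
  obtain ⟨G, hG, eG⟩ := exists_extension_of_hasDerivWithinAt
    (fun y hy => (hg y hy).hasDerivWithinAt) hG₁c eG₁
  have hGc : Continuous G := continuous_iff_continuousAt.2 fun x => (hG x).continuousAt
  have hk := continuous_goursat (c := c) hf hφ
  have hk₁ : Continuous (Function.uncurry fun ξ η => (1 / 2) * f ξ + ∫ t in (0:ℝ)..η, φ ξ t) :=
    (continuous_const.mul (hf.comp continuous_fst)).add (continuous_integral_snd hφ)
  have hk₂ := continuous_integral_fst (c := c) hφ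
  have hd₁ := hasDerivAt_goursat_fst (c := c) hf hφ
  have hd₂ := hasDerivAt_goursat_snd (c := c) (f := f) hφ
  have hd₂₁ := hasDerivAt_goursat_snd_fst (c := c) hφ
  have hl : ∀ x : ℝ, Continuous fun y : ℝ => (x - y, y) := fun x => by fun_prop
  have hkx : ∀ x, Continuous fun y => goursat c f φ (x - y) y := fun x => hk.comp (hl x)
  have hkz : ∀ {x y : ℝ}, x - y ≤ c → goursat c f φ (x - y) y = 0 := fun h =>
    goursat_eq_zero hf0 hφ0 h _
  let J : ℝ → ℂ := fun x => ∫ y in (0:ℝ)..R, goursat c f φ (x - y) y * G (x - 2 * y)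
  let J₁ : ℝ → ℂ := fun x => goursat c f φ x 0 * G x + ∫ y in (0:ℝ)..R,
    ((∫ s in c..(x - y), φ s y) * G (x - 2 * y) - goursat c f φ (x - y) y * G₁ (x - 2 * y))
  have hJ : ∀ x ≤ c + R, HasDerivAt J (J₁ x) x := fun x hx =>
    hasDerivAt_transform hk hk₁ hk₂ hd₁ hd₂ hG₁c hG (hkz (by linarith))
  have hJ₁ := fun (x : ℝ) (hx : x ≤ c + R) =>
    hasDerivAt_transform_deriv (R := R) hk hk₁ hk₂ hφ hd₁ hd₂ hd₂₁ hG₂ hG hG₁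
      (hkz (x := x) (y := R) (by linarith))
  have hmem : ∀ {x y : ℝ}, x ≤ c + R → y ∈ Icc 0 R → ¬ x - y ≤ c →
      x - y ∈ Icc c (c + R) ∧ x - 2 * y ∈ Icc (c - R) (c + R) := fun hx hy h =>
    ⟨⟨by linarith, by linarith [hy.1]⟩, by linarith [hy.2], by linarith [hy.1]⟩
  refine ⟨fun x => 2 * J x, fun x => 2 * J₁ x, fun x hx => (hJ x hx).const_mul 2,
    fun x hx => ((hJ₁ x hx).const_mul 2).congr_deriv ?_, fun x hx => ?_, fun x hx => ?_⟩
  · have e1 : ∫ y in (0:ℝ)..R,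
        (φ (x - y) y * G (x - 2 * y) + goursat c f φ (x - y) y * G₂ (x - 2 * y)) =
        (lam + Q x) * J x + ∫ y in (0:ℝ)..R, goursat c f φ (x - y) y * H (x - 2 * y) := by
      have := hkx x
      simp only [J]
      rw [← intervalIntegral.integral_const_mul, ← intervalIntegral.integral_add
        (Continuous.intervalIntegrable (by fun_prop) _ _)
        (Continuous.intervalIntegrable (by fun_prop) _ _)]
      refine integral_congr fun y hy => ?_
      rw [uIcc_of_le hR.le] at hy
      by_cases h : x - y ≤ c
      · simp only [hkz h, hφ0 _ h]
        ring
      · obtain ⟨h1, h2⟩ := hmem hx hy h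
        simp only [hφκ _ h1 _ hy, eG₂ _ h2, eG _ h2, sub_add_cancel]
        rw [show x - y - y = x - 2 * y by ring]
        ring
    have e2 : f x * G x = f x * g x := by
      rcases le_total x c with h | h
      · simp [hf0 x h]
      · rw [eG x ⟨by linarith, hx⟩]
    rw [e1, ← e2, integral_same]
    ring
  · have h0 : ∀ y ∈ uIcc 0 R, x - y ≤ c := fun y hy => by
      rw [uIcc_of_le hR.le] at hy
      linarith [hy.1]
    have e1 : J x = ∫ y in (0:ℝ)..R, (0 : ℂ) := integral_congr fun y hy => by
      simp only [hkz (h0 y hy), zero_mul]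
    have e2 : J₁ x = 0 + ∫ y in (0:ℝ)..R, (0 : ℂ) := by
      simp only [J₁]
      rw [goursat_eq_zero hf0 hφ0 hx, zero_mul]
      refine congrArg _ (integral_congr fun y hy => ?_)
      simp only [hkz (h0 y hy), integral_fst_eq_zero hφ0 (h0 y hy), zero_mul, sub_zero]
    simp [e1, e2]
  · rw [norm_mul, Complex.norm_ofNat]
    refine mul_le_mul_of_nonneg_left ?_ (by norm_num)
    refine (intervalIntegral.norm_integral_le_of_norm_le_const (C := K * D)
      fun y hy => ?_).trans (by rw [sub_zero, abs_of_pos hR])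
    rw [uIoc_of_le hR.le] at hy
    have hK0 : 0 ≤ K := (norm_nonneg _).trans (hK c (by simp [hR.le]) 0 (by simp [hR.le]))
    have hD0 : 0 ≤ D := (norm_nonneg _).trans (hD c ⟨by linarith, by linarith⟩)
    by_cases h : x - y ≤ c
    · rw [hkz h, zero_mul, norm_zero]
      positivity
    · obtain ⟨h1, h2⟩ := hmem hx ⟨hy.1.le, hy.2⟩ h
      rw [norm_mul, eG _ h2]
      exact mul_le_mul (hK _ h1 _ ⟨hy.1.le, hy.2⟩) (hD _ h2) (norm_nonneg _) hK0

/-- A family of solutions of `g'' = (-σ s + P) g + β - exp (-s T) μ` on `[0, L]`, indexed by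
the closed right half plane and decaying like `1 / (1 + Re s)`. -/
structure IsResolventFamily (L T C : ℝ) (σ : ℂ) (P β μ : ℝ → ℂ) (g g₁ : ℂ → ℝ → ℂ) : Prop where
  cont : ∀ s : ℂ, 0 ≤ s.re → ContinuousOn (g s) (Icc 0 L)
  cont₁ : ∀ s : ℂ, 0 ≤ s.re → ContinuousOn (g₁ s) (Icc 0 L)
  deriv : ∀ s : ℂ, 0 ≤ s.re → ∀ x ∈ Ioo 0 L, HasDerivAt (g s) (g₁ s x) x
  deriv₁ : ∀ s : ℂ, 0 ≤ s.re → ∀ x ∈ Ioo 0 L, HasDerivAt (g₁ s)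
    ((-σ * s + P x) * g s x + (β x - Complex.exp (-s * T) * μ x)) x
  bound : ∀ s : ℂ, 0 ≤ s.re → ∀ x ∈ Icc 0 L, ‖g s x‖ ≤ C / (1 + s.re)

set_option maxHeartbeats 1000000 in
/-- If the potentials agree on `[0, c]`, they agree slightly beyond `c`. -/
theorem IsResolventFamily.exists_eqOn_Ico {L T C : ℝ} (hT : 0 < T) {σ : ℂ} {P Q β β₁ μ ν : ℝ → ℂ}
    {g g₁ v v₁ : ℂ → ℝ → ℂ} (hP : Continuous P) (hQ : Continuous Q)
    (hβ : ∀ x ∈ Ioo 0 L, HasDerivAt β (β₁ x) x) (hβ₁ : ContinuousOn β₁ (Ioo 0 L))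
    (hβ0 : ∀ x ∈ Ioo 0 L, β x = 0 → β₁ x ≠ 0) (hμ : ContinuousOn μ (Icc 0 L))
    (hν : ContinuousOn ν (Icc 0 L)) (hg : IsResolventFamily L T C σ P β μ g g₁)
    (hv : IsResolventFamily L T C σ Q β ν v v₁)
    (h0 : ∀ s : ℂ, 0 ≤ s.re → g s 0 = v s 0) (h0₁ : ∀ s : ℂ, 0 ≤ s.re → g₁ s 0 = v₁ s 0)
    {c : ℝ} (hc : c ∈ Ioo 0 L) (hPQ : ∀ x ∈ Icc 0 c, P x = Q x) :
    ∃ r > 0, ∀ x ∈ Ico c (c + r), P x = Q x := by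
  let f : ℝ → ℂ := fun x => Q (max c x) - P (max c x)
  have hf : Continuous f := by fun_prop
  have hf0 : ∀ s ≤ c, f s = 0 := fun s hs => by
    simp only [f, max_eq_left hs, hPQ c ⟨hc.1.le, le_rfl⟩, sub_self]
  have hfQP : ∀ x, 0 ≤ x → Q x - P x = f x := fun x hx => by
    rcases le_total x c with h | h
    · rw [hf0 x h, hPQ x ⟨hx, h⟩, sub_self]
    · simp only [f, max_eq_right h]
  let κ : ℝ → ℝ → ℂ := fun ξ η => Q (ξ + η) - P (ξ - η)
  have hκ : Continuous (Function.uncurry κ) := by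
    simp only [κ, Function.uncurry_def]
    fun_prop
  obtain ⟨d, hd, φ, hφ, hφ0, hφκ⟩ := exists_goursat c hf hκ
  replace hφ0 := hφ0 hf0
  obtain ⟨R, hR, hRd, hRc, hRL⟩ : ∃ R > 0, R ≤ d ∧ 0 < c - R ∧ c + R < L := by
    refine ⟨min d (min (c / 2) ((L - c) / 2)), ?_, min_le_left _ _, ?_, ?_⟩
    · have := hc.1
      have : 0 < L - c := by linarith [hc.2]
      positivity
    · have := (min_le_right d (min (c / 2) ((L - c) / 2))).trans (min_le_left _ _)
      linarith [hc.1]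
    · have := (min_le_right d (min (c / 2) ((L - c) / 2))).trans (min_le_right _ _)
      linarith [hc.2]
  have hφκ' : ∀ ξ ∈ Icc c (c + R), ∀ η ∈ Icc 0 R,
      φ ξ η = (Q (ξ + η) - P (ξ - η)) * goursat c f φ ξ η := fun ξ hξ η hη =>
    hφκ ξ ⟨hξ.1, by linarith [hξ.2]⟩ η ⟨by linarith [hη.1], by linarith [hη.2]⟩
  have hk := continuous_goursat (c := c) hf hφ
  obtain ⟨K, hK⟩ := (isCompact_Icc.prod isCompact_Icc).exists_bound_of_continuousOn
    (s := Icc c (c + R) ×ˢ Icc (0:ℝ) R) hk.continuousOn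
  have hsub : Icc (c - R) (c + R) ⊆ Ioo 0 L := fun y hy =>
    ⟨by linarith [hy.1], by linarith [hy.2]⟩
  have hsub' : Icc (c - R) (c + R) ⊆ Icc 0 L := hsub.trans Ioo_subset_Icc_self
  have hW : c - R ≤ c + R := by linarith
  obtain ⟨B₁, hB₁, eB₁⟩ := exists_continuous_extension hW (hβ₁.mono hsub)
  obtain ⟨B, hB, eB⟩ := exists_extension_of_hasDerivWithinAt
    (fun y hy => (hβ y (hsub hy)).hasDerivWithinAt) hB₁ eB₁
  have hBc : Continuous B := continuous_iff_continuousAt.2 fun x => (hB x).continuousAt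
  obtain ⟨m, hm, em⟩ := exists_continuous_extension hW (hμ.mono hsub')
  have hex : ∀ s : ℂ, ∃ I I₁ : ℝ → ℂ, 0 ≤ s.re → (∀ x ≤ c + R, HasDerivAt I (I₁ x) x) ∧
      (∀ x ≤ c + R, HasDerivAt I₁ (f x * g s x + (-σ * s + Q x) * I x +
        2 * ∫ y in (0:ℝ)..R, goursat c f φ (x - y) y *
          (B (x - 2 * y) - Complex.exp (-s * T) * m (x - 2 * y))) x) ∧
      (∀ x ≤ c, I x = 0 ∧ I₁ x = 0) ∧
      ∀ x ≤ c + R, ‖I x‖ ≤ 2 * (K * (C / (1 + s.re)) * R) := by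
    intro s
    by_cases hs : 0 ≤ s.re
    · obtain ⟨I, I₁, h⟩ := exists_transform (lam := -σ * s) (g := g s) (g₁ := g₁ s)
        (H := fun y => B y - Complex.exp (-s * T) * m y) hR hf hφ hf0 hφ0 hφκ'
        (fun ξ hξ η hη => hK (ξ, η) ⟨hξ, hη⟩) hP (by fun_prop)
        (fun y hy => hg.deriv s hs y (hsub hy))
        (fun y hy => by rw [eB y hy, em y hy]; exact hg.deriv₁ s hs y (hsub hy))
        (fun y hy => hg.bound s hs y (hsub' hy))
      exact ⟨I, I₁, fun _ => h⟩
    · exact ⟨0, 0, fun h => absurd h hs⟩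
  choose I I₁ hI using hex
  let tr : (ℝ → ℂ) → ℝ → ℂ := fun w x =>
    ∫ y in (0:ℝ)..R, goursat c f φ (x - y) y * w (x - 2 * y)
  have htr : ∀ w, Continuous w → Continuous (tr w) := fun w hw => by
    have : Continuous fun z : ℝ × ℝ => goursat c f φ (z.1 - z.2) z.2 :=
      hk.comp (by fun_prop : Continuous fun z : ℝ × ℝ => (z.1 - z.2, z.2))
    exact continuous_parametric_intervalIntegral_of_continuous'
      (f := fun x y => goursat c f φ (x - y) y * w (x - 2 * y))
      (by simp only [Function.uncurry_def]; fun_prop) _ _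
  have htr_sub : ∀ (e : ℂ) x, tr (fun y => B y - e * m y) x = tr B x - e * tr m x := by
    intro e x
    have : Continuous fun y : ℝ => goursat c f φ (x - y) y :=
      hk.comp (by fun_prop : Continuous fun y : ℝ => (x - y, y))
    simp only [tr]
    rw [← intervalIntegral.integral_const_mul, ← intervalIntegral.integral_sub
        (Continuous.intervalIntegrable (by fun_prop) _ _)
        (Continuous.intervalIntegrable (by fun_prop) _ _)]
    refine integral_congr fun y _ => ?_
    ring
  have hX : 0 < c + R := by linarith [hc.1]
  have hXL : Icc 0 (c + R) ⊆ Icc 0 L := Icc_subset_Icc_right hRL.le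
  have hA := forcing_eq_zero_of_hasDerivAt (X := c + R) (C := C + C + 2 * (K * C * R)) hX hT
    (σ := σ) (q := Q)
    (A := fun x => -2 * tr B x) (U := fun x => ν x - μ x - 2 * tr m x)
    (Z := fun s x => v s x - g s x - I s x) (Z₁ := fun s x => v₁ s x - g₁ s x - I₁ s x)
    hQ.continuousOn (by have := htr B hBc; fun_prop)
    (by
      have := (htr m hm).continuousOn (s := Icc 0 (c + R))
      have := hν.mono hXL
      have := hμ.mono hXL
      fun_prop)
    (fun s hs => (((hv.cont s hs).mono hXL).sub ((hg.cont s hs).mono hXL)).sub fun x hx =>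
      ((hI s hs).1 x hx.2).continuousAt.continuousWithinAt)
    (fun s hs => (((hv.cont₁ s hs).mono hXL).sub ((hg.cont₁ s hs).mono hXL)).sub fun x hx =>
      ((hI s hs).2.1 x hx.2).continuousAt.continuousWithinAt)
    (fun s hs x hx => ((hv.deriv s hs x ⟨hx.1, hx.2.trans hRL⟩).sub
      (hg.deriv s hs x ⟨hx.1, hx.2.trans hRL⟩)).sub ((hI s hs).1 x hx.2.le))
    (fun s hs x hx => by
      refine (((hv.deriv₁ s hs x ⟨hx.1, hx.2.trans hRL⟩).sub
        (hg.deriv₁ s hs x ⟨hx.1, hx.2.trans hRL⟩)).sub ((hI s hs).2.1 x hx.2.le)).congr_deriv ?_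
      have e := htr_sub (Complex.exp (-s * T)) x
      change ∫ y in (0:ℝ)..R, goursat c f φ (x - y) y *
          (B (x - 2 * y) - Complex.exp (-s * T) * m (x - 2 * y)) = _ at e
      rw [e, ← hfQP x hx.1.le]
      ring)
    (fun s hs => by simp [h0 s hs, ((hI s hs).2.2.1 0 hc.1.le).1])
    (fun s hs => by simp [h0₁ s hs, ((hI s hs).2.2.1 0 hc.1.le).2])
    (fun s hs x hx => by
      refine (norm_sub_le _ _).trans ((add_le_add ((norm_sub_le _ _).trans
        (add_le_add (hv.bound s hs x (hXL hx)) (hg.bound s hs x (hXL hx))))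
        ((hI s hs).2.2.2 x hx.2)).trans (le_of_eq ?_))
      ring)
  have hk₁ : Continuous (Function.uncurry fun ξ η => (1 / 2) * f ξ + ∫ t in (0:ℝ)..η, φ ξ t) :=
    (continuous_const.mul (hf.comp continuous_fst)).add (continuous_integral_snd hφ)
  have hvolt : ∀ x ∈ Ioo c (c + R), goursat c f φ x 0 * B x + ∫ y in (0:ℝ)..R,
      ((∫ s in c..(x - y), φ s y) * B (x - 2 * y) - goursat c f φ (x - y) y * B₁ (x - 2 * y)) =
      0 := by
    intro x hx
    have h1 := hasDerivAt_transform (R := R) hk hk₁ (continuous_integral_fst (c := c) hφ)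
      (hasDerivAt_goursat_fst hf hφ) (hasDerivAt_goursat_snd hφ) hB₁ hB (x := x)
      (goursat_eq_zero hf0 hφ0 (by linarith [hx.2]) _)
    refine h1.unique ((hasDerivAt_const x (0 : ℂ)).congr_of_eventuallyEq ?_)
    filter_upwards [Ioo_mem_nhds hx.1 hx.2] with y hy
    simpa [tr] using hA y ⟨by linarith [hy.1, hc.1], hy.2.le⟩
  obtain ⟨M, hM⟩ := (isCompact_Icc.prod isCompact_Icc).exists_bound_of_continuousOn
    (s := Icc c (c + R) ×ˢ Icc (0:ℝ) R) hκ.continuousOn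
  have hM0 : 0 ≤ M := (norm_nonneg _).trans (hM (c, 0) (by simp [hR.le]))
  have hcW : c ∈ Icc (c - R) (c + R) := ⟨by linarith, by linarith⟩
  have hr₁ : 0 < min (R / 2) (min 1 (1 / (16 * (M + 1)))) := by positivity
  obtain ⟨r, hr, hrr, S₀, S₁, hS, hSβ⟩ := exists_radius hr₁ hB₁ hB
    (by rw [eB c hcW, eB₁ c hcW]; exact hβ0 c hc)
  have hrR : r ≤ R / 2 := hrr.trans (min_le_left _ _)
  have hr1 : r ≤ 1 := hrr.trans ((min_le_right _ _).trans (min_le_left _ _))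
  have hrM : M * r ≤ 1 / 16 := by
    have : r ≤ 1 / (16 * (M + 1)) := hrr.trans ((min_le_right _ _).trans (min_le_right _ _))
    rw [le_div_iff₀ (by positivity)] at this
    nlinarith
  have hF := integral_eq_zero_of_volterra hf hφ hBc hB₁ hf0 hφ0 hr hr1 (by linarith) hM0 hrM
    (fun ξ hξ η hη => by
      have hξ' : ξ ∈ Icc c (c + R) := ⟨hξ.1, by linarith [hξ.2]⟩
      have hη' : η ∈ Icc 0 R := ⟨hη.1, by linarith [hη.2]⟩
      rw [hφκ' ξ hξ' η hη', norm_mul]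
      exact mul_le_mul_of_nonneg_right (hM (ξ, η) ⟨hξ', hη'⟩) (norm_nonneg _))
    hS hSβ (fun x hx => hvolt x ⟨hx.1, by linarith [hx.2]⟩)
  refine ⟨r, hr, fun x hx => ?_⟩
  rcases hx.1.eq_or_lt with rfl | hcx
  · exact hPQ _ ⟨hc.1.le, le_rfl⟩
  · have : f x = 0 := by
      refine (hf.integral_hasStrictDerivAt c x).hasDerivAt.unique
        ((hasDerivAt_const x (0 : ℂ)).congr_of_eventuallyEq ?_)
      filter_upwards [Ioo_mem_nhds hcx hx.2] with y hy using hF y ⟨hy.1.le, hy.2.le⟩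
    rw [← hfQP x (hc.1.le.trans hcx.le), sub_eq_zero] at this
    exact this.symm

theorem IsResolventFamily.eqOn {L T C ε : ℝ} (hT : 0 < T) {σ : ℂ} {P Q β β₁ μ ν : ℝ → ℂ}
    {g g₁ v v₁ : ℂ → ℝ → ℂ} (hP : Continuous P) (hQ : Continuous Q)
    (hβ : ∀ x ∈ Ioo 0 L, HasDerivAt β (β₁ x) x) (hβ₁ : ContinuousOn β₁ (Ioo 0 L))
    (hβ0 : ∀ x ∈ Ioo 0 L, β x = 0 → β₁ x ≠ 0) (hμ : ContinuousOn μ (Icc 0 L))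
    (hν : ContinuousOn ν (Icc 0 L)) (hg : IsResolventFamily L T C σ P β μ g g₁)
    (hv : IsResolventFamily L T C σ Q β ν v v₁)
    (h0 : ∀ s : ℂ, 0 ≤ s.re → g s 0 = v s 0) (h0₁ : ∀ s : ℂ, 0 ≤ s.re → g₁ s 0 = v₁ s 0)
    (hε : 0 < ε) (hPQ : ∀ x ∈ Icc 0 ε, P x = Q x) :
    ∀ x ∈ Icc 0 L, P x = Q x := by
  have hcl : IsClosed ({x | P x = Q x} ∩ Icc ε L) := (isClosed_eq hP hQ).inter isClosed_Icc
  have hsub := hcl.Icc_subset_of_forall_mem_nhdsGT_of_Icc_subset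
    (hPQ ε ⟨hε.le, le_rfl⟩) fun t ht htP => by
      obtain ⟨r, hr, h⟩ := hg.exists_eqOn_Ico hT hP hQ hβ hβ₁ hβ0 hμ hν hv h0 h0₁
        (c := t) ⟨hε.trans_le ht.1, ht.2⟩ fun x hx => by
          rcases le_total x ε with hxε | hxε
          · exact hPQ x ⟨hx.1, hxε⟩
          · exact htP ⟨hxε, hx.2⟩
      filter_upwards [Ioo_mem_nhdsGT (show t < t + r by linarith)] with x hx
      exact h x ⟨hx.1.le, hx.2⟩
  intro x hx
  rcases le_total x ε with hxε | hxε
  · exact hPQ x ⟨hx.1, hxε⟩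
  · exact hsub ⟨hxε, hx.2⟩

/-- A `C^{1,2}` function extends, in its space variable, to a twice continuously differentiable
function on the whole line. -/
theorem IsC12.exists_extension {T ℓ : ℝ} {u ut ux uxx : ℝ → ℝ → ℂ} (hT : 0 < T) (hℓ : 0 < ℓ)
    (hu : IsC12 T ℓ u ut ux uxx) :
    ∃ U U₁ U₂ : ℝ → ℝ → ℂ, Continuous (Function.uncurry U) ∧ Continuous (Function.uncurry U₁) ∧
      Continuous (Function.uncurry U₂) ∧ (∀ t x, HasDerivAt (U t) (U₁ t x) x) ∧
      (∀ t x, HasDerivAt (U₁ t) (U₂ t x) x) ∧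
      ∀ t ∈ Icc 0 T, ∀ x ∈ Icc 0 ℓ, U t x = u t x ∧ U₁ t x = ux t x ∧ U₂ t x = uxx t x := by
  obtain ⟨hd, hu, -, hux, huxx⟩ := hu
  let π : ℝ → ℝ := fun t => max 0 (min t T)
  have hπ : Continuous π := by fun_prop
  have hπm : ∀ t, π t ∈ Icc 0 T := fun t => ⟨le_max_left _ _, max_le hT.le (min_le_right _ _)⟩
  have hπe : ∀ t ∈ Icc 0 T, π t = t := fun t ht => by
    simp only [π, min_eq_left ht.2, max_eq_right ht.1]
  let ϖ : ℝ → ℝ := fun x => max 0 (min x ℓ)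
  have hϖ : Continuous ϖ := by fun_prop
  have hϖm : ∀ x, ϖ x ∈ Icc 0 ℓ := fun t => ⟨le_max_left _ _, max_le hℓ.le (min_le_right _ _)⟩
  have hϖe : ∀ x ∈ Icc 0 ℓ, ϖ x = x := fun x hx => by
    simp only [ϖ, min_eq_left hx.2, max_eq_right hx.1]
  have h0 : (0:ℝ) ∈ Icc 0 ℓ := ⟨le_rfl, hℓ.le⟩
  have key : ∀ (w w₁ W : ℝ → ℝ → ℂ),
      ContinuousOn (fun z : ℝ × ℝ => w z.1 z.2) (Icc 0 T ×ˢ Icc 0 ℓ) →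
      (∀ t ∈ Icc 0 T, ∀ x ∈ Icc 0 ℓ,
        HasDerivWithinAt (fun y => w t y) (w₁ t x) (Icc 0 ℓ) x) →
      Continuous (Function.uncurry W) → (∀ t ∈ Icc 0 T, ∀ x ∈ Icc 0 ℓ, W t x = w₁ t x) →
      ∃ V : ℝ → ℝ → ℂ, Continuous (Function.uncurry V) ∧ (∀ t x, HasDerivAt (V t) (W t x) x) ∧
        ∀ t ∈ Icc 0 T, ∀ x ∈ Icc 0 ℓ, V t x = w t x := by
    intro w w₁ W hw hw₁ hW hWw
    have hWt : ∀ t, Continuous (W t) := fun t =>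
      hW.comp (by fun_prop : Continuous fun x : ℝ => (t, x))
    have hw0 : Continuous fun t => w (π t) 0 :=
      hw.comp_continuous (by fun_prop : Continuous fun t => (π t, (0:ℝ))) fun t => ⟨hπm t, h0⟩
    refine ⟨fun t x => w (π t) 0 + ∫ y in (0:ℝ)..x, W t y,
      (hw0.comp continuous_fst).add (continuous_integral_snd hW), fun t x =>
      ((hWt t).integral_hasStrictDerivAt 0 x).hasDerivAt.const_add _, fun t ht x hx => ?_⟩
    obtain ⟨V, hV, eV⟩ := exists_extension_of_hasDerivWithinAt (hw₁ t ht) (hWt t) (hWw t ht)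
    simp only [hπe t ht, ← eV 0 h0, ← eV x hx,
      integral_eq_sub_of_hasDerivAt (fun y _ => hV y) ((hWt t).intervalIntegrable 0 x)]
    ring
  obtain ⟨U₁, hU₁, hd₁, eU₁⟩ := key ux uxx (fun t x => uxx (π t) (ϖ x)) hux
    (fun t ht x hx => (hd t ht x hx).2.2)
    (huxx.comp_continuous (by fun_prop : Continuous fun z : ℝ × ℝ => (π z.1, ϖ z.2))
      fun z => ⟨hπm _, hϖm _⟩) (fun t ht x hx => by rw [hπe t ht, hϖe x hx])
  obtain ⟨U, hU, hd₀, eU⟩ := key u ux U₁ hu (fun t ht x hx => (hd t ht x hx).2.1) hU₁ eU₁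
  exact ⟨U, U₁, fun t x => uxx (π t) (ϖ x), hU, hU₁,
    huxx.comp_continuous (by fun_prop : Continuous fun z : ℝ × ℝ => (π z.1, ϖ z.2))
      fun z => ⟨hπm _, hϖm _⟩, hd₀, hd₁, fun t ht x hx =>
    ⟨eU t ht x hx, eU₁ t ht x hx, by simp only [hπe t ht, hϖe x hx]⟩⟩

theorem integral_exp_le {T r : ℝ} (hT : 0 ≤ T) (hr : 0 ≤ r) :
    ∫ t in (0:ℝ)..T, Real.exp (-r * (T - t)) ≤ (1 + T) / (1 + r) := by
  have hc : Continuous fun t => Real.exp (-r * (T - t)) := by fun_prop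
  have h1 : ∫ t in (0:ℝ)..T, Real.exp (-r * (T - t)) ≤ T := by
    refine (integral_mono_on (g := fun _ => (1:ℝ)) hT (hc.intervalIntegrable _ _)
      (continuous_const.intervalIntegrable _ _) fun t ht => ?_).trans (by simp)
    rw [Real.exp_le_one_iff]
    nlinarith [ht.2]
  have h2 : r * ∫ t in (0:ℝ)..T, Real.exp (-r * (T - t)) ≤ 1 := by
    rw [← intervalIntegral.integral_const_mul, integral_eq_sub_of_hasDerivAt
      (f := fun t => Real.exp (-r * (T - t))) (fun t _ => ?_)
      (Continuous.intervalIntegrable (by fun_prop) _ _)]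
    · simp only [sub_self, mul_zero, Real.exp_zero]
      linarith [Real.exp_pos (-r * (T - 0))]
    · refine ((((hasDerivAt_id t).const_sub T).const_mul (-r)).exp).congr_deriv ?_
      simp only [id]
      ring
  rw [le_div_iff₀ (by linarith)]
  linarith

theorem norm_integral_exp_mul_le {T M : ℝ} (hT : 0 ≤ T) {w : ℝ → ℂ}
    (hM : ∀ t ∈ Icc 0 T, ‖w t‖ ≤ M) {s : ℂ} (hs : 0 ≤ s.re) :
    ‖∫ t in (0:ℝ)..T, Complex.exp (-s * (T - t)) * w t‖ ≤ M * (1 + T) / (1 + s.re) := by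
  have hM0 : 0 ≤ M := (norm_nonneg _).trans (hM 0 ⟨le_rfl, hT⟩)
  have hle : ‖∫ t in (0:ℝ)..T, Complex.exp (-s * (T - t)) * w t‖ ≤
      ∫ t in (0:ℝ)..T, M * Real.exp (-s.re * (T - t)) := by
    refine norm_integral_le_of_norm_le hT (Filter.Eventually.of_forall fun t ht => ?_)
      (Continuous.intervalIntegrable (by fun_prop) _ _)
    have : (-s * (T - t)).re = -s.re * (T - t) := by
      simp [Complex.mul_re]
    rw [norm_mul, Complex.norm_exp, this, mul_comm M]
    exact mul_le_mul_of_nonneg_left (hM t ⟨ht.1.le, ht.2⟩) (Real.exp_pos _).le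
  refine hle.trans ?_
  rw [intervalIntegral.integral_const_mul, mul_div_assoc]
  exact mul_le_mul_of_nonneg_left (integral_exp_le hT hs) hM0

/-- The Laplace transform in reversed time of a solution of `σ ∂ₜu = a ∂ₓ²u - p u` with
`u(T, ·) = b`. -/
theorem IsC12.exists_laplace {T ℓ : ℝ} (hT : 0 < T) (hℓ : 0 < ℓ) {σ : ℂ} {p a : ℝ → ℝ}
    {b : ℝ → ℂ} {u ut ux uxx : ℝ → ℝ → ℂ} (hu : IsC12 T ℓ u ut ux uxx)
    (hpde : ∀ t ∈ Ioo (0:ℝ) T, ∀ x ∈ Ioo (0:ℝ) ℓ,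
      σ * ut t x = a x * uxx t x - p x * u t x)
    (hfin : ∀ x ∈ Ioo (0:ℝ) ℓ, u T x = b x) :
    ∃ (M : ℝ) (w w₁ w₂ : ℂ → ℝ → ℂ), (∀ s x, HasDerivAt (w s) (w₁ s x) x) ∧
      (∀ s x, HasDerivAt (w₁ s) (w₂ s x) x) ∧
      (∀ s, ∀ x ∈ Ioo 0 ℓ, a x * w₂ s x =
        (p x - σ * s) * w s x + σ * (b x - Complex.exp (-s * T) * u 0 x)) ∧
      (∀ s : ℂ, 0 ≤ s.re → ∀ x ∈ Icc 0 ℓ, ‖w s x‖ ≤ M / (1 + s.re)) ∧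
      ∀ s, w s 0 = (∫ t in (0:ℝ)..T, Complex.exp (-s * (T - t)) * u t 0) ∧
        w₁ s 0 = ∫ t in (0:ℝ)..T, Complex.exp (-s * (T - t)) * ux t 0 := by
  obtain ⟨U, U₁, U₂, hU, hU₁, hU₂, hd, hd₁, he⟩ := hu.exists_extension hT hℓ
  have hsw : ∀ W : ℝ → ℝ → ℂ, Continuous (Function.uncurry W) →
      Continuous fun z : ℝ × ℝ => W z.2 z.1 := fun W hW =>
    hW.comp (by fun_prop : Continuous fun z : ℝ × ℝ => (z.2, z.1))
  have hc : ∀ (s : ℂ) (W : ℝ → ℝ → ℂ), Continuous (Function.uncurry W) → Continuous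
      (Function.uncurry fun (x t : ℝ) => Complex.exp (-s * ((T:ℂ) - (t:ℂ))) * W t x) := fun s W hW => by
    have := hsw W hW
    simp only [Function.uncurry_def]
    fun_prop
  have hcx : ∀ (s : ℂ) (W : ℝ → ℝ → ℂ), Continuous (Function.uncurry W) → ∀ x, Continuous
      fun t : ℝ => Complex.exp (-s * ((T:ℂ) - (t:ℂ))) * W t x := fun s W hW x =>
    (hc s W hW).comp (by fun_prop : Continuous fun t : ℝ => (x, t))
  have h0 : (0:ℝ) ∈ Icc 0 ℓ := ⟨le_rfl, hℓ.le⟩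
  obtain ⟨M, hM⟩ := (isCompact_Icc.prod isCompact_Icc).exists_bound_of_continuousOn
    (s := Icc (0:ℝ) T ×ˢ Icc (0:ℝ) ℓ) hU.continuousOn
  refine ⟨M * (1 + T), fun s x => ∫ t in (0:ℝ)..T, Complex.exp (-s * (T - t)) * U t x,
    fun s x => ∫ t in (0:ℝ)..T, Complex.exp (-s * (T - t)) * U₁ t x,
    fun s x => ∫ t in (0:ℝ)..T, Complex.exp (-s * (T - t)) * U₂ t x,
    fun s x => hasDerivAt_integral_param (hc s U hU) (hc s U₁ hU₁)
      (fun x t => (hd t x).const_mul _) 0 T x,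
    fun s x => hasDerivAt_integral_param (hc s U₁ hU₁) (hc s U₂ hU₂)
      (fun x t => (hd₁ t x).const_mul _) 0 T x, fun s x hx => ?_, fun s hs x hx =>
    norm_integral_exp_mul_le hT.le (fun t ht => hM (t, x) ⟨ht, hx⟩) hs, fun s => ⟨?_, ?_⟩⟩
  · have hx' := Ioo_subset_Icc_self hx
    have hint : ∫ t in (0:ℝ)..T, (σ * s * (Complex.exp (-s * (T - t)) * U t x) +
        (a x * (Complex.exp (-s * (T - t)) * U₂ t x) -
          p x * (Complex.exp (-s * (T - t)) * U t x))) =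
        σ * (Complex.exp (-s * (T - T)) * U T x) - σ * (Complex.exp (-s * (T - (0:ℝ))) * U 0 x) := by
      have h1 := hcx s U hU x
      have h2 := hcx s U₂ hU₂ x
      refine integral_eq_sub_of_hasDerivAt_of_le
        (f := fun t : ℝ => σ * (Complex.exp (-s * (T - t)) * U t x)) hT.le
        (by fun_prop) (fun t ht => ?_) (Continuous.intervalIntegrable (by fun_prop) _ _)
      have ht' := Ioo_subset_Icc_self ht
      have e1 : HasDerivAt (fun t : ℝ => Complex.exp (-s * (T - t)))
          (s * Complex.exp (-s * (T - t))) t := by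
        refine (((((hasDerivAt_id t).ofReal_comp).const_sub (T:ℂ)).const_mul (-s)).cexp).congr_deriv
          ?_
        simp only [id, Complex.ofReal_one]
        ring
      have e2 : HasDerivAt (fun t => U t x) (ut t x) t := by
        refine ((hu.1 t ht' x hx').1.hasDerivAt (Icc_mem_nhds ht.1 ht.2)).congr_of_eventuallyEq ?_
        filter_upwards [Icc_mem_nhds ht.1 ht.2] with τ hτ using (he τ hτ x hx').1
      refine ((e1.mul e2).const_mul σ).congr_deriv ?_
      obtain ⟨e3, -, e4⟩ := he t ht' x hx'
      have := hpde t ht x hx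
      rw [e3, e4]
      linear_combination (Complex.exp (-s * (T - t))) * this
    have h1 := hcx s U hU x
    have h2 := hcx s U₂ hU₂ x
    rw [intervalIntegral.integral_add (Continuous.intervalIntegrable (by fun_prop) _ _)
        (Continuous.intervalIntegrable (by fun_prop) _ _), intervalIntegral.integral_sub
        (Continuous.intervalIntegrable (by fun_prop) _ _)
        (Continuous.intervalIntegrable (by fun_prop) _ _), intervalIntegral.integral_const_mul,
      intervalIntegral.integral_const_mul, intervalIntegral.integral_const_mul,
      (he T ⟨hT.le, le_rfl⟩ x hx').1, (he 0 ⟨le_rfl, hT.le⟩ x hx').1, hfin x hx] at hint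
    simp only [sub_self, mul_zero, Complex.exp_zero, Complex.ofReal_zero, sub_zero] at hint
    linear_combination hint
  · refine integral_congr fun t ht => ?_
    rw [uIcc_of_le hT.le] at ht
    simp only [(he t ht 0 h0).1]
  · refine integral_congr fun t ht => ?_
    rw [uIcc_of_le hT.le] at ht
    simp only [(he t ht 0 h0).2.1]

/-- The change of variables `x = γ y` from `[0, L]` to `[0, ℓ]` with `γ' = √(a ∘ γ)`, together
with a `C²` fourth root `α` of `a`. -/
structure IsLiouvilleChange (ℓ L : ℝ) (a γ α α₁ α₂ : ℝ → ℝ) : Prop where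
  pos : 0 < L
  map_zero : γ 0 = 0
  map_right : γ L = ℓ
  strictMono : StrictMono γ
  cont : Continuous γ
  deriv : ∀ y ∈ Icc 0 L, HasDerivAt γ (α (γ y) ^ 2) y
  cont₂ : Continuous α₂
  hasDerivAt : ∀ x, HasDerivAt α (α₁ x) x
  hasDerivAt₁ : ∀ x, HasDerivAt α₁ (α₂ x) x
  root_pos : ∀ x ∈ Icc 0 ℓ, 0 < α x
  root_pow : ∀ x ∈ Icc 0 ℓ, α x ^ 4 = a x

theorem exists_isLiouvilleChange {ℓ : ℝ} (hℓ : 0 < ℓ) {a : ℝ → ℝ}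
    (ha : ContDiffOn ℝ 2 a (Icc 0 ℓ)) (hapos : ∀ x ∈ Icc (0:ℝ) ℓ, 0 < a x) :
    ∃ (L : ℝ) (γ α α₁ α₂ : ℝ → ℝ), IsLiouvilleChange ℓ L a γ α α₁ α₂ := by
  have hs : ContDiffOn ℝ 2 (fun x => √(√(a x))) (Icc 0 ℓ) :=
    (ha.sqrt fun x hx => (hapos x hx).ne').sqrt fun x hx => (Real.sqrt_pos.2 (hapos x hx)).ne'
  obtain ⟨α₁, α₂, hα₂, hα₁, eα₁, -⟩ := exists_extension_of_contDiffOn hℓ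
    (hs.derivWithin (m := 1) (uniqueDiffOn_Icc hℓ) (by norm_num))
  have hα₁c : Continuous α₁ := continuous_iff_continuousAt.2 fun x => (hα₁ x).continuousAt
  obtain ⟨α, hα, eα⟩ := exists_extension_of_hasDerivWithinAt (fun x hx =>
    ((hs.differentiableOn two_ne_zero) x hx).hasDerivWithinAt) hα₁c eα₁
  have hαc : Continuous α := continuous_iff_continuousAt.2 fun x => (hα x).continuousAt
  have hαpos : ∀ x ∈ Icc 0 ℓ, 0 < α x := fun x hx => by
    rw [eα x hx]
    exact Real.sqrt_pos.2 (Real.sqrt_pos.2 (hapos x hx))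
  let π : ℝ → ℝ := fun x => max 0 (min x ℓ)
  have hπ : Continuous π := by fun_prop
  have hπm : ∀ x, π x ∈ Icc 0 ℓ := fun x => ⟨le_max_left _ _, max_le hℓ.le (min_le_right _ _)⟩
  have hπe : ∀ x ∈ Icc 0 ℓ, π x = x := fun x hx => by
    simp only [π, min_eq_left hx.2, max_eq_right hx.1]
  have hpos : ∀ x, 0 < α (π x) := fun x => hαpos _ (hπm x)
  let k : ℝ → ℝ := fun x => (α (π x) ^ 2)⁻¹
  have hk : Continuous k :=
    ((hαc.comp hπ).pow 2).inv₀ fun x => (pow_pos (hpos x) 2).ne'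
  have hkpos : ∀ x, 0 < k x := fun x => inv_pos.2 (pow_pos (hpos x) 2)
  let h : ℝ → ℝ := fun x => ∫ t in (0:ℝ)..x, k t
  have hh : ∀ x, HasDerivAt h (k x) x := fun x => (hk.integral_hasStrictDerivAt 0 x).hasDerivAt
  have hhc : Continuous h := continuous_iff_continuousAt.2 fun x => (hh x).continuousAt
  have hmono : StrictMono h := strictMono_of_deriv_pos fun x => by
    rw [(hh x).deriv]
    exact hkpos x
  obtain ⟨m, hm, hmk⟩ : ∃ m > 0, ∀ x, m ≤ k x := by
    obtain ⟨x₀, -, hx₀⟩ := isCompact_Icc.exists_isMinOn (nonempty_Icc.2 hℓ.le) hk.continuousOn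
    refine ⟨k x₀, hkpos x₀, fun x => (hx₀ (hπm x)).trans_eq ?_⟩
    simp only [k, hπe _ (hπm x)]
  have hd : ∀ x, HasDerivAt (fun x => h x - m * x) (k x - m * 1) x := fun x =>
    (hh x).sub ((hasDerivAt_id x).const_mul m)
  have hlin : Monotone fun x => h x - m * x :=
    monotone_of_deriv_nonneg (fun x => (hd x).differentiableAt) fun x => by
      rw [(hd x).deriv]
      linarith [hmk x]
  have h0 : h 0 = 0 := integral_same
  have hsurj : Function.Surjective h := by
    refine hhc.surjective ?_ ?_
    · refine Filter.tendsto_atTop_mono' _ ?_ (Filter.tendsto_id.const_mul_atTop hm)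
      filter_upwards [Filter.eventually_ge_atTop 0] with x hx
      have := hlin hx
      simp only [h0, mul_zero, sub_zero] at this
      simp only [id]
      linarith
    · refine Filter.tendsto_atBot_mono' _ ?_ (Filter.tendsto_id.const_mul_atBot hm)
      filter_upwards [Filter.eventually_le_atBot 0] with x hx
      have := hlin hx
      simp only [h0, mul_zero, sub_zero] at this
      simp only [id]
      linarith
  let e : ℝ ≃o ℝ := hmono.orderIsoOfSurjective h hsurj
  have he : ∀ x, e x = h x := fun x => rfl
  have hes : ∀ y, h (e.symm y) = y := fun y => e.apply_symm_apply y
  have hse : ∀ x, e.symm (h x) = x := fun x => e.symm_apply_apply x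
  have hsc : Continuous e.symm := e.symm.continuous
  have hs0 : e.symm 0 = 0 := by rw [← h0, hse, h0]
  refine ⟨h ℓ, e.symm, α, α₁, α₂, ?_, hs0, hse ℓ, e.symm.strictMono, hsc, fun y hy => ?_, hα₂, hα,
    hα₁, hαpos, fun x hx => ?_⟩
  · rw [← h0]
    exact hmono hℓ
  · have hmem : e.symm y ∈ Icc 0 ℓ :=
      ⟨by rw [← hs0]; exact e.symm.monotone hy.1, by rw [← hse ℓ]; exact e.symm.monotone hy.2⟩
    have := HasDerivAt.of_local_left_inverse hsc.continuousAt (hh (e.symm y)) (hkpos _).ne'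
      (Filter.Eventually.of_forall hes)
    simpa only [k, inv_inv, hπe _ hmem] using this
  · rw [eα x hx, show √(√(a x)) ^ 4 = (√(√(a x)) ^ 2) ^ 2 by ring,
      Real.sq_sqrt (Real.sqrt_nonneg _), Real.sq_sqrt (hapos x hx).le]

namespace IsLiouvilleChange

variable {ℓ L : ℝ} {a γ α α₁ α₂ : ℝ → ℝ}

theorem mem_Icc (h : IsLiouvilleChange ℓ L a γ α α₁ α₂) {y : ℝ} (hy : y ∈ Icc 0 L) :
    γ y ∈ Icc 0 ℓ :=
  ⟨by rw [← h.map_zero]; exact h.strictMono.monotone hy.1,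
    by rw [← h.map_right]; exact h.strictMono.monotone hy.2⟩

theorem mem_Ioo (h : IsLiouvilleChange ℓ L a γ α α₁ α₂) {y : ℝ} (hy : y ∈ Ioo 0 L) :
    γ y ∈ Ioo 0 ℓ :=
  ⟨by rw [← h.map_zero]; exact h.strictMono hy.1, by rw [← h.map_right]; exact h.strictMono hy.2⟩

theorem exists_eq (h : IsLiouvilleChange ℓ L a γ α α₁ α₂) {x : ℝ} (hx : x ∈ Icc 0 ℓ) :
    ∃ y ∈ Icc 0 L, γ y = x := by
  have := intermediate_value_Icc h.pos.le h.cont.continuousOn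
  rw [h.map_zero, h.map_right] at this
  exact this hx

theorem root_ne_zero (h : IsLiouvilleChange ℓ L a γ α α₁ α₂) {y : ℝ} (hy : y ∈ Icc 0 L) :
    (α (γ y) : ℂ) ≠ 0 :=
  Complex.ofReal_ne_zero.2 (h.root_pos _ (h.mem_Icc hy)).ne'

theorem cont_root (h : IsLiouvilleChange ℓ L a γ α α₁ α₂) : Continuous α :=
  continuous_iff_continuousAt.2 fun x => (h.hasDerivAt x).continuousAt

theorem cont_root_deriv (h : IsLiouvilleChange ℓ L a γ α α₁ α₂) : Continuous α₁ :=
  continuous_iff_continuousAt.2 fun x => (h.hasDerivAt₁ x).continuousAt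

theorem hasDerivAt_comp (h : IsLiouvilleChange ℓ L a γ α α₁ α₂) {w w₁ : ℝ → ℂ} {y : ℝ}
    (hw : HasDerivAt w (w₁ (γ y)) (γ y)) (hy : y ∈ Icc 0 L) :
    HasDerivAt (fun y => w (γ y)) ((α (γ y) : ℂ) ^ 2 * w₁ (γ y)) y := by
  refine (hw.scomp y (h.deriv y hy)).congr_deriv ?_
  simp

theorem hasDerivAt_div (h : IsLiouvilleChange ℓ L a γ α α₁ α₂) {w w₁ : ℝ → ℂ} {y : ℝ}
    (hw : HasDerivAt w (w₁ (γ y)) (γ y)) (hy : y ∈ Icc 0 L) :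
    HasDerivAt (fun y => w (γ y) / α (γ y)) (α (γ y) * w₁ (γ y) - α₁ (γ y) * w (γ y)) y := by
  have hα := h.root_ne_zero hy
  refine ((h.hasDerivAt_comp hw hy).div
    (h.hasDerivAt_comp (w₁ := fun x => α₁ x) (h.hasDerivAt _).ofReal_comp hy) hα).congr_deriv ?_
  field_simp

/-- The Laplace transform of a solution, in the Liouville variable. -/
theorem exists_isResolventFamily (h : IsLiouvilleChange ℓ L a γ α α₁ α₂) {T : ℝ} (hT : 0 < T)
    (hℓ : 0 < ℓ) {σ : ℂ} {p : ℝ → ℝ} {b : ℝ → ℂ} {u ut ux uxx : ℝ → ℝ → ℂ}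
    (hu : IsC12 T ℓ u ut ux uxx)
    (hpde : ∀ t ∈ Ioo (0:ℝ) T, ∀ x ∈ Ioo (0:ℝ) ℓ,
      σ * ut t x = a x * uxx t x - p x * u t x)
    (hfin : ∀ x ∈ Ioo (0:ℝ) ℓ, u T x = b x) {P : ℝ → ℂ}
    (hP : ∀ y ∈ Icc 0 L, P y = p (γ y) - α (γ y) ^ 3 * α₂ (γ y)) :
    ∃ (C : ℝ) (g g₁ : ℂ → ℝ → ℂ), 0 ≤ C ∧ IsResolventFamily L T C σ P
      (fun y => σ * b (γ y) / α (γ y)) (fun y => σ * u 0 (γ y) / α (γ y)) g g₁ ∧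
      ∀ s, g s 0 = (∫ t in (0:ℝ)..T, Complex.exp (-s * (T - t)) * u t 0) / α 0 ∧
        g₁ s 0 = α 0 * (∫ t in (0:ℝ)..T, Complex.exp (-s * (T - t)) * ux t 0) -
          α₁ 0 * ∫ t in (0:ℝ)..T, Complex.exp (-s * (T - t)) * u t 0 := by
  obtain ⟨M, w, w₁, w₂, hw, hw₁, hode, hM, h0⟩ := hu.exists_laplace hT hℓ hpde hfin
  have h0L : (0:ℝ) ∈ Icc 0 L := ⟨le_rfl, h.pos.le⟩
  have hcα : Continuous fun y => (α (γ y) : ℂ) :=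
    Complex.continuous_ofReal.comp (h.cont_root.comp h.cont)
  have hcα₁ : Continuous fun y => (α₁ (γ y) : ℂ) :=
    Complex.continuous_ofReal.comp (h.cont_root_deriv.comp h.cont)
  have hcw : ∀ s, Continuous fun y => w s (γ y) := fun s =>
    (continuous_iff_continuousAt.2 fun x => (hw s x).continuousAt).comp h.cont
  have hcw₁ : ∀ s, Continuous fun y => w₁ s (γ y) := fun s =>
    (continuous_iff_continuousAt.2 fun x => (hw₁ s x).continuousAt).comp h.cont
  obtain ⟨A, hA⟩ := isCompact_Icc.exists_bound_of_continuousOn (s := Icc 0 L)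
    (hcα.continuousOn.inv₀ fun y hy => h.root_ne_zero hy)
  have hA0 : 0 ≤ A := (norm_nonneg _).trans (hA 0 h0L)
  have hM0 : 0 ≤ M := by
    have := (norm_nonneg _).trans (hM 0 (by simp) 0 ⟨le_rfl, hℓ.le⟩)
    simpa using this
  refine ⟨M * A, fun s y => w s (γ y) / α (γ y),
    fun s y => α (γ y) * w₁ s (γ y) - α₁ (γ y) * w s (γ y), by positivity,
    ⟨fun s _ => (hcw s).continuousOn.div hcα.continuousOn fun y hy => h.root_ne_zero hy,
    fun s _ => ((hcα.mul (hcw₁ s)).sub (hcα₁.mul (hcw s))).continuousOn,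
    fun s _ y hy => h.hasDerivAt_div (hw s _) (Ioo_subset_Icc_self hy), fun s _ y hy => ?_,
    fun s hs y hy => ?_⟩, fun s => ?_⟩
  · have hy' := Ioo_subset_Icc_self hy
    have hα := h.root_ne_zero hy'
    have hα₀ := h.hasDerivAt_comp (w₁ := fun x => α₁ x) (h.hasDerivAt (γ y)).ofReal_comp hy'
    have hα₁ := h.hasDerivAt_comp (w₁ := fun x => α₂ x) (h.hasDerivAt₁ (γ y)).ofReal_comp hy'
    refine ((hα₀.mul (h.hasDerivAt_comp (hw₁ s _) hy')).sub
      (hα₁.mul (h.hasDerivAt_comp (hw s _) hy'))).congr_deriv ?_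
    have e := hode s (γ y) (h.mem_Ioo hy)
    rw [← h.root_pow _ (h.mem_Icc hy')] at e
    push_cast at e
    rw [hP y hy']
    generalize Complex.exp (-s * T) = E at e ⊢
    field_simp
    linear_combination e
  · rw [div_eq_mul_inv, norm_mul, mul_div_right_comm]
    exact mul_le_mul (hM s hs _ (h.mem_Icc hy)) (hA y hy) (norm_nonneg _)
      (div_nonneg hM0 (by linarith))
  · simp only [h.map_zero, (h0 s).1, (h0 s).2, and_self]

end IsLiouvilleChange

theorem IsResolventFamily.mono {L T C C' : ℝ} {σ : ℂ} {P β μ : ℝ → ℂ} {g g₁ : ℂ → ℝ → ℂ}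
    (h : IsResolventFamily L T C σ P β μ g g₁) (hC : C ≤ C') :
    IsResolventFamily L T C' σ P β μ g g₁ :=
  ⟨h.cont, h.cont₁, h.deriv, h.deriv₁, fun s hs x hx =>
    (h.bound s hs x hx).trans (div_le_div_of_nonneg_right hC (by linarith))⟩

theorem stmt_3
    (T ℓ : ℝ) (hT : 0 < T) (hℓ : 0 < ℓ)
    (σ : ℂ) (hσ : σ ≠ 0)
    (p q a : ℝ → ℝ)
    (hp : ContDiffOn ℝ 1 p (Icc 0 ℓ)) (hq : ContDiffOn ℝ 1 q (Icc 0 ℓ))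
    (ha : ContDiffOn ℝ 2 a (Icc 0 ℓ)) (hapos : ∀ x ∈ Icc (0:ℝ) ℓ, 0 < a x)
    (b : ℝ → ℂ) (hb : ContDiffOn ℝ 3 b (Icc 0 ℓ))
    (hbfin : {x ∈ Icc (0:ℝ) ℓ | b x = 0}.Finite)
    (hbord : ∀ x ∈ Icc (0:ℝ) ℓ, b x = 0 → derivWithin b (Icc 0 ℓ) x ≠ 0)
    (u ut ux uxx v vt vx vxx : ℝ → ℝ → ℂ)
    (hu : IsC12 T ℓ u ut ux uxx) (hv : IsC12 T ℓ v vt vx vxx)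
    (hupde : ∀ t ∈ Ioo (0:ℝ) T, ∀ x ∈ Ioo (0:ℝ) ℓ,
      σ * ut t x = a x * uxx t x - p x * u t x)
    (hvpde : ∀ t ∈ Ioo (0:ℝ) T, ∀ x ∈ Ioo (0:ℝ) ℓ,
      σ * vt t x = a x * vxx t x - q x * v t x)
    (hinit : ∀ x ∈ Ioo (0:ℝ) ℓ, u T x = b x ∧ v T x = b x)
    (hdir : ∀ t ∈ Ioo (0:ℝ) T, u t 0 = v t 0)
    (hneu : ∀ t ∈ Ioo (0:ℝ) T, ux t 0 = vx t 0)
    (hcoin : ∃ ε : ℝ, 0 < ε ∧ ε < ℓ ∧ ∀ x ∈ Icc (0:ℝ) ε, p x = q x)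
    : ∀ x ∈ Icc (0:ℝ) ℓ, p x = q x := by
  obtain ⟨ε, hε, hεℓ, hpq⟩ := hcoin
  obtain ⟨L, γ, α, α₁, α₂, h⟩ := exists_isLiouvilleChange hℓ ha hapos
  obtain ⟨B, B₁, hB₁, hB, eB, eB₁⟩ := exists_extension_of_contDiffOn hℓ (hb.of_le (by norm_num))
  have hBc : Continuous B := continuous_iff_continuousAt.2 fun x => (hB x).continuousAt
  have hsub : Ioo 0 L ⊆ Icc 0 L := Ioo_subset_Icc_self
  have hcα : Continuous fun y => (α (γ y) : ℂ) :=
    Complex.continuous_ofReal.comp (h.cont_root.comp h.cont)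
  have hcα₁ : Continuous fun y => (α₁ (γ y) : ℂ) :=
    Complex.continuous_ofReal.comp (h.cont_root_deriv.comp h.cont)
  have hcα₂ : Continuous fun y => (α₂ (γ y) : ℂ) :=
    Complex.continuous_ofReal.comp (h.cont₂.comp h.cont)
  have hcpot : ∀ r : ℝ → ℝ, ContinuousOn r (Icc 0 ℓ) → ∃ R : ℝ → ℂ, Continuous R ∧
      ∀ y ∈ Icc 0 L, R y = r (γ y) - α (γ y) ^ 3 * α₂ (γ y) := fun r hr => by
    refine exists_continuous_extension h.pos.le (ContinuousOn.sub ?_ (by fun_prop))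
    exact Complex.continuous_ofReal.comp_continuousOn
      (hr.comp h.cont.continuousOn fun y hy => h.mem_Icc hy)
  have hcu : ∀ w wt wx wxx : ℝ → ℝ → ℂ, IsC12 T ℓ w wt wx wxx →
      ContinuousOn (fun y => σ * w 0 (γ y) / α (γ y)) (Icc 0 L) := fun w wt wx wxx hw => by
    refine (continuousOn_const.mul ?_).div hcα.continuousOn fun y hy => h.root_ne_zero hy
    have hc := h.cont
    exact hw.2.1.comp (by fun_prop : ContinuousOn (fun y => ((0:ℝ), γ y)) (Icc 0 L)) fun y hy =>
      ⟨⟨le_rfl, hT.le⟩, h.mem_Icc hy⟩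
  obtain ⟨P, hPc, eP⟩ := hcpot p hp.continuousOn
  obtain ⟨Q, hQc, eQ⟩ := hcpot q hq.continuousOn
  have hfin : ∀ x ∈ Ioo 0 ℓ, u T x = B x ∧ v T x = B x := fun x hx => by
    rw [eB x (Ioo_subset_Icc_self hx)]
    exact hinit x hx
  obtain ⟨C, g, g₁, hC, hg, hg0⟩ := h.exists_isResolventFamily hT hℓ hu hupde
    (fun x hx => (hfin x hx).1) eP
  obtain ⟨D, f, f₁, hD, hf, hf0⟩ := h.exists_isResolventFamily hT hℓ hv hvpde
    (fun x hx => (hfin x hx).2) eQ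
  have hlat : ∀ (s : ℂ) (w z : ℝ → ℂ), (∀ t ∈ Ioo 0 T, w t = z t) →
      ∫ t in (0:ℝ)..T, Complex.exp (-s * (T - t)) * w t =
        ∫ t in (0:ℝ)..T, Complex.exp (-s * (T - t)) * z t := fun s w z hwz => by
    rw [integral_of_le hT.le, integral_of_le hT.le, integral_Ioc_eq_integral_Ioo,
      integral_Ioc_eq_integral_Ioo]
    exact setIntegral_congr_fun measurableSet_Ioo fun t ht => by simp only [hwz t ht]
  have hu0 := fun s => hlat s (fun t => u t 0) (fun t => v t 0) hdir
  have hux0 := fun s => hlat s (fun t => ux t 0) (fun t => vx t 0) hneu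
  obtain ⟨δ, hδ, eδ⟩ := h.exists_eq ⟨hε.le, hεℓ.le⟩
  have hδ0 : 0 < δ := by
    rw [← h.strictMono.lt_iff_lt, h.map_zero, eδ]
    exact hε
  have key := (hg.mono (le_add_of_nonneg_right hD)).eqOn hT (ε := δ) hPc hQc
    (β₁ := fun y => α (γ y) * (σ * B₁ (γ y)) - α₁ (γ y) * (σ * B (γ y)))
    (fun y hy => h.hasDerivAt_div (w := fun x => σ * B x) (w₁ := fun x => σ * B₁ x)
      ((hB _).const_mul σ) (hsub hy))
    ((hcα.mul (continuous_const.mul (hB₁.comp h.cont))).sub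
      (hcα₁.mul (continuous_const.mul (hBc.comp h.cont)))).continuousOn
    (fun y hy hy0 => by
      have hα := h.root_ne_zero (hsub hy)
      have hm := h.mem_Icc (hsub hy)
      have hBy : B (γ y) = 0 := by simpa [hσ, hα] using hy0
      have hb₁ := hbord (γ y) hm (by rw [← eB _ hm, hBy])
      rw [← eB₁ _ hm] at hb₁
      simp [hBy, hσ, hα, hb₁])
    (hcu u ut ux uxx hu) (hcu v vt vx vxx hv) (hf.mono (le_add_of_nonneg_left hC))
    (fun s _ => by rw [(hg0 s).1, (hf0 s).1, hu0])
    (fun s _ => by rw [(hg0 s).2, (hf0 s).2, hu0, hux0])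
    hδ0 (fun y hy => by
      have hy' : y ∈ Icc 0 L := ⟨hy.1, hy.2.trans hδ.2⟩
      rw [eP y hy', eQ y hy', hpq (γ y) ⟨(h.mem_Icc hy').1, by
        rw [← eδ]
        exact h.strictMono.monotone hy.2⟩])
  intro x hx
  obtain ⟨y, hy, rfl⟩ := h.exists_eq hx
  have := key y hy
  rw [eP y hy, eQ y hy, sub_left_inj] at this
  exact_mod_cast this
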